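/- arXiv:cond-mat/0403736 — 8 statements merged into one kernel-verified Lean document; each statement's English description precedes it below -/
import Mathlib

section
/- Let N be an even positive integer, M an odd positive integer with 2M ≤ N, let N_a be a positive integer with N ≤ N_a, and let U > 0. Then the Lieb–Wu equations admit at least one real solution (k_1,…,k_N, Λ_1,…,Λ_M) satisfying −π ≤ k_1 < k_2 < ⋯ < k_N ≤ π and Λ_1 < Λ_2 < ⋯ < Λ_M. -/
open Real

/-- The phase function `θ_U(x) = -2 arctan(2x/U)` of the Lieb–Wu equations. -/
noncomputable def theta (U x : ℝ) : ℝ := -2 * Real.arctan (2 * x / U)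

theorem exists_lipschitz_projection {E : Type*} [NormedAddCommGroup E] [InnerProductSpace ℝ E]
    {K : Set E} (hne : K.Nonempty) (hcomp : IsComplete K) (hconv : Convex ℝ K) :
    ∃ P : E → E, LipschitzWith 1 P ∧ (∀ x, P x ∈ K) ∧
      ∀ x, ∀ y ∈ K, inner ℝ (x - P x) (y - P x) ≤ 0 := by
  choose P hPK hP using exists_norm_eq_iInf_of_complete_convex hne hcomp hconv
  have hin : ∀ x, ∀ y ∈ K, inner ℝ (x - P x) (y - P x) ≤ 0 := fun x =>
    (norm_eq_iInf_iff_real_inner_le_zero hconv (hPK x)).1 (hP x)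
  refine ⟨P, LipschitzWith.of_dist_le_mul fun x y => ?_, hPK, hin⟩
  rw [NNReal.coe_one, one_mul, dist_eq_norm, dist_eq_norm]
  have h1 := hin x (P y) (hPK y)
  have h2 := hin y (P x) (hPK x)
  have h3 : inner ℝ (P x - P y) (P x - P y) ≤ inner ℝ (x - y) (P x - P y) := by
    simp only [inner_sub_left, inner_sub_right] at *
    linarith
  rw [real_inner_self_eq_norm_sq] at h3
  have h4 := real_inner_le_norm (x - y) (P x - P y)
  by_contra! h
  nlinarith [norm_nonneg (x - y), norm_nonneg (P x - P y)]

theorem eq_of_inner_sub_le_zero {E : Type*} [NormedAddCommGroup E] [InnerProductSpace ℝ E]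
    {x p q : E} (hp : inner ℝ (x - p) (q - p) ≤ 0) (hq : inner ℝ (x - q) (p - q) ≤ 0) :
    p = q := by
  have h : inner ℝ (p - q) (p - q) ≤ 0 := by
    simp only [inner_sub_left, inner_sub_right] at *
    linarith
  rw [real_inner_self_eq_norm_sq] at h
  have h0 : ‖p - q‖ = 0 := by nlinarith [norm_nonneg (p - q)]
  exact sub_eq_zero.1 (norm_eq_zero.1 h0)

/-- The metric projection onto a closed ball centred at the origin. -/
theorem exists_lipschitz_radial_projection {E : Type*} [NormedAddCommGroup E]
    [InnerProductSpace ℝ E] [CompleteSpace E] {r : ℝ} (hr : 0 < r) :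
    ∃ P : E → E, LipschitzWith 1 P ∧ (∀ x, ‖P x‖ ≤ r) ∧ (∀ x, ‖x‖ ≤ r → P x = x) ∧
      ∀ x, r ≤ ‖x‖ → P x = (r / ‖x‖) • x := by
  obtain ⟨P, hL, hK, hP⟩ := exists_lipschitz_projection (K := Metric.closedBall (0 : E) r)
    ⟨0, by simp [hr.le]⟩ Metric.isClosed_closedBall.isComplete (convex_closedBall 0 r)
  simp only [mem_closedBall_zero_iff] at hK hP
  refine ⟨P, hL, hK, fun x hx => eq_of_inner_sub_le_zero (hP x x hx) (by simp), fun x hx => ?_⟩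
  have hx0 : 0 < ‖x‖ := hr.trans_le hx
  have hq : ‖(r / ‖x‖) • x‖ = r := by
    rw [norm_smul, Real.norm_of_nonneg (by positivity)]
    field_simp
  refine eq_of_inner_sub_le_zero (hP x _ hq.le) ?_
  have h1 : x - (r / ‖x‖) • x = (1 - r / ‖x‖) • x := by rw [sub_smul, one_smul]
  rw [h1, real_inner_smul_left, inner_sub_right, real_inner_smul_right,
    real_inner_self_eq_norm_sq]
  have h2 : inner ℝ x (P x) ≤ ‖x‖ * r :=
    (real_inner_le_norm _ _).trans (mul_le_mul_of_nonneg_left (hK x) hx0.le)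
  have h3 : r / ‖x‖ * ‖x‖ ^ 2 = ‖x‖ * r := by field_simp
  have h4 : r / ‖x‖ ≤ 1 := (div_le_one hx0).2 hx
  rw [h3]
  exact mul_nonpos_of_nonneg_of_nonpos (by linarith) (by linarith)

theorem exists_interpolation_weights {n : ℕ} {t : Fin (n + 1) → ℝ} (ht : Function.Injective t)
    (a : ℝ) : ∃ c : Fin (n + 1) → ℝ, ∀ p : Polynomial ℝ, p.natDegree ≤ n →
      p.eval a = ∑ i, c i * p.eval (t i) := by
  refine ⟨fun i => (Lagrange.basis Finset.univ t i).eval a, fun p hp => ?_⟩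
  have h := Lagrange.eq_interpolate (s := Finset.univ) (v := t) (f := p) ht.injOn (by
    rw [Finset.card_univ, Fintype.card_fin]
    exact Polynomial.degree_le_natDegree.trans_lt (Nat.cast_lt.2 (Nat.lt_succ_of_le hp)))
  conv_lhs => rw [h, Lagrange.interpolate_apply]
  simp [Polynomial.eval_finsetSum, mul_comm]

theorem exists_polynomial_eval_eq_det_one_add_smul {E : Type*} [NormedAddCommGroup E]
    [NormedSpace ℝ E] [FiniteDimensional ℝ E] (A : E →L[ℝ] E) :
    ∃ p : Polynomial ℝ, p.natDegree ≤ Module.finrank ℝ E ∧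
      ∀ t : ℝ, p.eval t = (1 + t • A).det := by
  let b := Module.finBasis ℝ E
  let B := LinearMap.toMatrix b b (A : E →ₗ[ℝ] E)
  refine ⟨((Polynomial.X : Polynomial ℝ) • B.map Polynomial.C +
    (1 : Matrix (Fin (Module.finrank ℝ E)) (Fin (Module.finrank ℝ E)) ℝ).map
      Polynomial.C).det, ?_, fun t => ?_⟩
  · simpa using Polynomial.natDegree_det_X_add_C_le B 1
  · rw [ContinuousLinearMap.det, ← LinearMap.det_toMatrix b, ← Polynomial.coe_evalRingHom,
      RingHom.map_det]
    congr 1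
    have h1 : LinearMap.toMatrix b b ((1 + t • A : E →L[ℝ] E) : E →ₗ[ℝ] E) = 1 + t • B := by
      ext i j
      simp [B, LinearMap.toMatrix_apply, Matrix.one_apply, Finsupp.single_apply, eq_comm]
    rw [h1]
    ext i j
    by_cases hij : i = j <;> simp [hij, add_comm, mul_comm t]

open MeasureTheory in
theorem exists_small_det_integral_eq_volume_ball {E : Type*} [NormedAddCommGroup E]
    [InnerProductSpace ℝ E] [FiniteDimensional ℝ E] [MeasurableSpace E] [BorelSpace E]
    {L : NNReal} {h : E → E} (hL : LipschitzWith L h) {r : ℝ}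
    (hout : ∀ x, r ≤ ‖x‖ → h x = 0) :
    ∃ ε > 0, ∀ t : ℝ, 0 < t → t < ε →
      IntegrableOn (fun x => (1 + t • fderiv ℝ h x).det)
        (Metric.ball 0 r ∩ {x | DifferentiableAt ℝ h x}) ∧
      ∫ x in Metric.ball 0 r ∩ {x | DifferentiableAt ℝ h x}, (1 + t • fderiv ℝ h x).det =
        volume.real (Metric.ball (0 : E) r) := by
  set D : Set E := Metric.ball 0 r ∩ {x | DifferentiableAt ℝ h x} with hD
  have hDm : MeasurableSet D :=
    Metric.isOpen_ball.measurableSet.inter (measurableSet_of_differentiableAt ℝ h)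
  have hdet : ∀ᶠ B : E →L[ℝ] E in nhds 1, 0 < B.det := by
    have := (ContinuousLinearMap.continuous_det (𝕜 := ℝ) (E := E)).tendsto 1
    refine this.eventually (lt_mem_nhds ?_)
    simp [ContinuousLinearMap.det]
  obtain ⟨η, hη, hdet⟩ := Metric.eventually_nhds_iff.1 hdet
  have h1 := addHaar_image_le_mul_of_det_lt (volume : Measure E) (1 : E →L[ℝ] E) (m := 2)
    (by simp [ContinuousLinearMap.det])
  have h2 : ∀ᶠ δ : NNReal in nhdsWithin 0 (Set.Ioi 0), δ < 1 ∧ (δ : ℝ) < η := by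
    refine Filter.Eventually.filter_mono nhdsWithin_le_nhds ?_
    refine (gt_mem_nhds zero_lt_one).and ?_
    exact (NNReal.continuous_coe.tendsto 0).eventually (gt_mem_nhds (by simpa using hη))
  obtain ⟨δ, ⟨hδ, hδ1, hδη⟩, hδ0⟩ := ((h1.and h2).and self_mem_nhdsWithin).exists
  have hδ0 : 0 < (δ : ℝ) := hδ0
  refine ⟨δ / (L + 1), by positivity, fun t ht htε => ?_⟩
  have htL : t * L ≤ δ := by
    rw [lt_div_iff₀ (by positivity)] at htε
    nlinarith
  let g : E → E := fun x => x + t • h x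
  have happrox : ∀ s : Set E, ApproximatesLinearOn g (1 : E →L[ℝ] E) s δ := by
    intro s x _ y _
    have : g x - g y - (1 : E →L[ℝ] E) (x - y) = t • (h x - h y) := by
      simp only [g, one_apply_eq_self, smul_sub]
      abel
    rw [this, norm_smul, Real.norm_of_nonneg ht.le]
    have h3 := hL.norm_sub_le x y
    calc t * ‖h x - h y‖ ≤ t * (L * ‖x - y‖) := mul_le_mul_of_nonneg_left h3 ht.le
      _ = t * L * ‖x - y‖ := by ring
      _ ≤ δ * ‖x - y‖ := mul_le_mul_of_nonneg_right htL (norm_nonneg _)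
  have hinj : Function.Injective g := by
    intro x y hxy
    have h3 := happrox Set.univ x trivial y trivial
    rw [hxy, sub_self, zero_sub, norm_neg, one_apply_eq_self] at h3
    have h4 : (δ : ℝ) < 1 := hδ1
    have h5 : ‖x - y‖ = 0 := by nlinarith [norm_nonneg (x - y)]
    exact sub_eq_zero.1 (norm_eq_zero.1 h5)
  have hsurj : Function.Surjective g := by
    have h3 : ApproximatesLinearOn g (ContinuousLinearEquiv.refl ℝ E : E →L[ℝ] E) Set.univ δ :=
      happrox Set.univ
    refine h3.surjective ?_
    rcases subsingleton_or_nontrivial E with hE | hE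
    · exact Or.inl hE
    · right
      have : ‖((ContinuousLinearEquiv.refl ℝ E).symm : E →L[ℝ] E)‖₊ = 1 := by
        ext
        exact ContinuousLinearMap.norm_id
      rw [this, inv_one]
      exact hδ1
  have hgout : ∀ x, r ≤ ‖x‖ → g x = x := fun x hx => by simp [g, hout x hx]
  have hball : g '' Metric.ball 0 r = Metric.ball 0 r := by
    have h3 : g '' (Metric.ball 0 r)ᶜ = (Metric.ball 0 r)ᶜ := by
      have : Set.EqOn g id (Metric.ball 0 r)ᶜ := fun x hx => hgout x (by simpa using hx)
      rw [this.image_eq, Set.image_id]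
    rw [Set.image_compl_eq ⟨hinj, hsurj⟩] at h3
    exact compl_injective h3
  have hnull : volume (Metric.ball 0 r \ D) = 0 := by
    refine measure_mono_null (fun x hx => ?_) (hL.ae_differentiableAt (μ := volume))
    exact fun hx' => hx.2 ⟨hx.1, hx'⟩
  have hnull' : volume (g '' (Metric.ball 0 r \ D)) = 0 := by
    have := hδ _ _ (happrox (Metric.ball 0 r \ D))
    rw [hnull, mul_zero] at this
    exact le_antisymm this zero_le
  have hvol : volume (g '' D) = volume (Metric.ball (0 : E) r) := by
    refine le_antisymm ?_ ?_
    · rw [← hball]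
      exact measure_mono (Set.image_mono Set.inter_subset_left)
    · calc volume (Metric.ball (0 : E) r)
          = volume (g '' (D ∪ Metric.ball 0 r \ D)) := by
            rw [Set.union_sdiff_cancel Set.inter_subset_left, hball]
        _ ≤ volume (g '' D) + volume (g '' (Metric.ball 0 r \ D)) := by
            rw [Set.image_union]; exact measure_union_le _ _
        _ = volume (g '' D) := by rw [hnull', add_zero]
  have hderiv : ∀ x ∈ D, HasFDerivWithinAt g (1 + t • fderiv ℝ h x) D x := fun x hx =>
    ((hasFDerivAt_id x).add (hx.2.hasFDerivAt.const_smul t)).hasFDerivWithinAt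
  have hpos : ∀ x, 0 < (1 + t • fderiv ℝ h x).det := by
    intro x
    refine hdet ?_
    rw [dist_eq_norm, add_sub_cancel_left, norm_smul, Real.norm_of_nonneg ht.le]
    have := norm_fderiv_le_of_lipschitz ℝ hL (x₀ := x)
    calc t * ‖fderiv ℝ h x‖ ≤ t * L := mul_le_mul_of_nonneg_left this ht.le
      _ ≤ δ := htL
      _ < η := hδη
  have hint := (integrableOn_image_iff_integrableOn_abs_det_fderiv_smul volume hDm hderiv
    hinj.injOn (fun _ => (1 : ℝ))).1
    (integrableOn_const (by rw [hvol]; exact measure_ball_lt_top.ne))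
  have heq := integral_image_eq_integral_abs_det_fderiv_smul volume hDm hderiv hinj.injOn
    (fun _ => (1 : ℝ))
  simp only [abs_of_pos (hpos _), smul_eq_mul, mul_one] at hint heq
  refine ⟨hint, ?_⟩
  rw [← heq, setIntegral_const, smul_eq_mul, mul_one, Measure.real, Measure.real, hvol]

open MeasureTheory in
/-- A Lipschitz version of the no-retraction theorem for the ball of radius `r`. -/
theorem not_lipschitz_retraction_sphere {E : Type*} [NormedAddCommGroup E]
    [InnerProductSpace ℝ E] [FiniteDimensional ℝ E]
    {L : NNReal} {h : E → E} (hL : LipschitzWith L h) {r : ℝ} (hr : 0 < r)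
    (hout : ∀ x, r ≤ ‖x‖ → h x = 0) (hin : ∀ x, ‖x‖ < r → ‖x + h x‖ = r) : False := by
  borelize E
  obtain ⟨ε, hε, hsmall⟩ := exists_small_det_integral_eq_volume_ball hL hout
  set D : Set E := Metric.ball 0 r ∩ {x | DifferentiableAt ℝ h x} with hD
  have hDm : MeasurableSet D :=
    Metric.isOpen_ball.measurableSet.inter (measurableSet_of_differentiableAt ℝ h)
  let n := Module.finrank ℝ E
  let t : Fin (n + 1) → ℝ := fun i => ε / ((i : ℝ) + 2)
  have htpos : ∀ i, 0 < t i := fun i => by positivity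
  have htlt : ∀ i, t i < ε := fun i => by
    have : (0 : ℝ) ≤ (i : ℕ) := Nat.cast_nonneg _
    exact div_lt_self hε (by linarith)
  have htinj : Function.Injective t := by
    intro i j hij
    simp only [t] at hij
    rw [div_eq_div_iff (by positivity) (by positivity)] at hij
    have := mul_left_cancel₀ hε.ne' hij
    exact Fin.ext (by exact_mod_cast (by linarith : (i : ℝ) = (j : ℝ)))
  obtain ⟨c, hc⟩ := exists_interpolation_weights htinj 1
  have hsum : ∑ i, c i = 1 := by
    have := hc 1 (by simp)
    simpa using this.symm
  have hcomb : ∀ x, (1 + (1 : ℝ) • fderiv ℝ h x).det =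
      ∑ i, c i * (1 + t i • fderiv ℝ h x).det := by
    intro x
    obtain ⟨p, hp, hpe⟩ := exists_polynomial_eval_eq_det_one_add_smul (fderiv ℝ h x)
    simp only [← hpe]
    exact hc p hp
  have hzero : ∀ x ∈ D, (1 + (1 : ℝ) • fderiv ℝ h x).det = 0 := by
    intro x hx
    by_contra hne
    have hxr : ‖x‖ < r := by simpa using hx.1
    have hd : HasFDerivAt (fun y => y + h y) (1 + (1 : ℝ) • fderiv ℝ h x) x := by
      rw [one_smul]
      exact (hasFDerivAt_id x).add hx.2.hasFDerivAt
    have hd2 := hd.norm_sq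
    have hev : (fun y => ‖y + h y‖ ^ 2) =ᶠ[nhds x] fun _ => r ^ 2 := by
      filter_upwards [Metric.isOpen_ball.mem_nhds hx.1] with y hy
      rw [hin y (by simpa using hy)]
    have hd3 := (hasFDerivAt_const (𝕜 := ℝ) (r ^ 2) x).congr_of_eventuallyEq hev
    have hd4 := hd2.unique hd3
    obtain ⟨v, hv⟩ : ∃ v, (1 + (1 : ℝ) • fderiv ℝ h x) v = x + h x := by
      have hu : IsUnit (LinearMap.det
          ((1 + (1 : ℝ) • fderiv ℝ h x : E →L[ℝ] E) : E →ₗ[ℝ] E)) := isUnit_iff_ne_zero.2 hne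
      exact ((LinearMap.equivOfIsUnitDet hu).surjective (x + h x)).imp fun v hv => by simpa using hv
    have hd5 := congrArg (fun T => T v) hd4
    simp only [smul_apply, ContinuousLinearMap.comp_apply, hv,
      zero_apply, innerSL_apply_apply, real_inner_self_eq_norm_sq,
      hin x hxr] at hd5
    have : 0 < r ^ 2 := by positivity
    simp at hd5
    exact hr.ne' hd5
  have hfin : (0 : ℝ) = volume.real (Metric.ball (0 : E) r) := by
    calc (0 : ℝ) = ∫ x in D, (1 + (1 : ℝ) • fderiv ℝ h x).det := by
          rw [setIntegral_congr_fun hDm hzero]; simp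
      _ = ∫ x in D, ∑ i, c i * (1 + t i • fderiv ℝ h x).det := by simp only [hcomb]
      _ = ∑ i, c i * ∫ x in D, (1 + t i • fderiv ℝ h x).det := by
          rw [integral_finsetSum _ fun i _ => ((hsmall _ (htpos i) (htlt i)).1.const_mul (c i))]
          simp only [integral_const_mul]
      _ = ∑ i, c i * volume.real (Metric.ball (0 : E) r) :=
          Finset.sum_congr rfl fun i _ => by rw [(hsmall _ (htpos i) (htlt i)).2]
      _ = volume.real (Metric.ball (0 : E) r) := by rw [← Finset.sum_mul, hsum, one_mul]
  have hvpos : 0 < volume.real (Metric.ball (0 : E) r) :=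
    ENNReal.toReal_pos (Metric.measure_ball_pos volume 0 hr).ne' measure_ball_lt_top.ne
  exact hvpos.ne hfin

/-- **Brouwer's fixed point theorem** for bounded Lipschitz maps. -/
theorem exists_fixedPoint_of_lipschitz_of_bounded {E : Type*} [NormedAddCommGroup E]
    [InnerProductSpace ℝ E] [FiniteDimensional ℝ E] {L : NNReal} {T : E → E}
    (hL : LipschitzWith L T) {R : ℝ} (hR : 0 ≤ R) (hT : ∀ x, ‖T x‖ ≤ R) : ∃ x, T x = x := by
  by_contra! hfix
  have hr : 0 < R + 1 := by linarith
  obtain ⟨p, hpL, hpr, hpin, hpout⟩ := exists_lipschitz_radial_projection (E := E) hr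
  let χ : E → ℝ := fun x => max 0 (min 1 (R + 1 - ‖x‖))
  have hχL : LipschitzWith 1 χ := by
    have h0 : LipschitzWith 1 (fun x : E => R + 1 - ‖x‖) := LipschitzWith.of_dist_le_mul
      fun x y => by
        rw [NNReal.coe_one, one_mul, Real.dist_eq, dist_eq_norm, abs_sub_comm]
        have : R + 1 - ‖y‖ - (R + 1 - ‖x‖) = ‖x‖ - ‖y‖ := by ring
        rw [this]
        exact abs_norm_sub_norm_le x y
    exact (h0.const_min 1).const_max 0
  have hχ0 : ∀ x, 0 ≤ χ x := fun x => le_max_left _ _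
  have hχ1 : ∀ x, χ x ≤ 1 := fun x => max_le zero_le_one (min_le_left _ _)
  let G : E → E := fun x => x - χ x • T x
  have hGL : LipschitzWith (1 + (L + R.toNNReal)) G := by
    refine LipschitzWith.id.sub (LipschitzWith.of_dist_le_mul fun x y => ?_)
    have h1 : χ x • T x - χ y • T y = χ x • (T x - T y) + (χ x - χ y) • T y := by
      rw [smul_sub, sub_smul]; abel
    rw [dist_eq_norm, dist_eq_norm, h1]
    have h2 := hL.norm_sub_le x y
    have h3 := hχL.norm_sub_le x y
    rw [NNReal.coe_one, one_mul] at h3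
    calc ‖χ x • (T x - T y) + (χ x - χ y) • T y‖
        ≤ ‖χ x‖ * ‖T x - T y‖ + ‖χ x - χ y‖ * ‖T y‖ := by
          rw [← norm_smul, ← norm_smul]; exact norm_add_le _ _
      _ ≤ 1 * (L * ‖x - y‖) + ‖x - y‖ * R := by
          have h4 : ‖χ x‖ ≤ 1 := by rw [Real.norm_of_nonneg (hχ0 x)]; exact hχ1 x
          gcongr
          exact hT y
      _ = ↑(L + R.toNNReal) * ‖x - y‖ := by
          push_cast
          rw [Real.coe_toNNReal R hR]
          ring
  have hG0 : ∀ x, G x ≠ 0 := by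
    intro x hx
    have hx1 : x = χ x • T x := sub_eq_zero.1 hx
    have hx2 : ‖x‖ ≤ R := by
      calc ‖x‖ = χ x * ‖T x‖ := by
            conv_lhs => rw [hx1]
            rw [norm_smul, Real.norm_of_nonneg (hχ0 x)]
        _ ≤ 1 * R := mul_le_mul (hχ1 x) (hT x) (norm_nonneg _) zero_le_one
        _ = R := one_mul R
    have hx3 : χ x = 1 := by
      have : (1 : ℝ) ≤ R + 1 - ‖x‖ := by linarith
      simp [χ, min_eq_left this]
    rw [hx3, one_smul] at hx1
    exact hfix x hx1.symm
  obtain ⟨x₀, -, hx₀⟩ := (isCompact_closedBall (0 : E) (R + 1)).exists_isMinOn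
    ⟨0, by simp [hr.le]⟩ hGL.continuous.norm.continuousOn
  have hδ : 0 < ‖G x₀‖ := norm_pos_iff.2 (hG0 x₀)
  have hGδ : ∀ x, ‖G x₀‖ ≤ ‖G (p x)‖ := fun x => hx₀ (by simpa using hpr x)
  obtain ⟨q, hqL, -, -, hqout⟩ := exists_lipschitz_radial_projection (E := E) hδ
  let f : E → E := fun x => ((R + 1) / ‖G x₀‖) • q (G (p x))
  have hf : ∀ x, f x = ((R + 1) / ‖G (p x)‖) • G (p x) := by
    intro x
    simp only [f]
    rw [hqout _ (hGδ x), smul_smul]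
    congr 1
    field_simp
  have hfL : LipschitzWith _ f :=
    (lipschitzWith_smul ((R + 1) / ‖G x₀‖)).comp (hqL.comp (hGL.comp hpL))
  refine not_lipschitz_retraction_sphere (hfL.sub hpL) hr (fun x hx => ?_) fun x hx => ?_
  · have hx0 : 0 < ‖x‖ := hr.trans_le hx
    have h1 : ‖p x‖ = R + 1 := by
      rw [hpout x hx, norm_smul, Real.norm_of_nonneg (by positivity)]
      field_simp
    have h2 : G (p x) = p x := by simp [G, χ, h1]
    rw [hf, h2, h1, div_self hr.ne', one_smul, sub_self]
  · have h1 : p x = x := hpin x hx.le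
    have h2 : 0 < ‖G x‖ := norm_pos_iff.2 (hG0 x)
    rw [hf, h1, add_sub_cancel, norm_smul, Real.norm_of_nonneg (by positivity)]
    field_simp

/-- A Lipschitz vector field on a compact convex set that points into the set at each of its points
has a zero. -/
theorem exists_zero_of_inward_lipschitz {E : Type*} [NormedAddCommGroup E]
    [InnerProductSpace ℝ E] [FiniteDimensional ℝ E] {K : Set E} (hne : K.Nonempty)
    (hcomp : IsCompact K) (hconv : Convex ℝ K) {L : NNReal} {V : E → E}
    (hL : LipschitzOnWith L V K) (hV : ∀ x ∈ K, ∃ ε : ℝ, 0 < ε ∧ x + ε • V x ∈ K) :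
    ∃ x ∈ K, V x = 0 := by
  obtain ⟨P, hPL, hPK, hP⟩ := exists_lipschitz_projection hne hcomp.isComplete hconv
  obtain ⟨R, hR⟩ := hcomp.isBounded.exists_norm_le
  have hVP : LipschitzWith (L * 1) (V ∘ P) := by
    rw [← lipschitzOnWith_univ]
    exact hL.comp (lipschitzOnWith_univ.2 hPL) fun x _ => hPK x
  obtain ⟨x, hx⟩ := exists_fixedPoint_of_lipschitz_of_bounded (hPL.comp (hPL.add hVP))
    ((norm_nonneg _).trans (hR _ (hPK 0))) fun x => hR _ (hPK _)
  simp only [Function.comp_apply] at hx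
  have hxK : x ∈ K := hx ▸ hPK _
  have hPx : P x = x :=
    eq_of_inner_sub_le_zero (hP x x hxK) (by simp)
  rw [hPx] at hx
  refine ⟨x, hxK, ?_⟩
  obtain ⟨ε, hε, hxε⟩ := hV x hxK
  have h := hP (x + V x) _ hxε
  rw [hx, add_sub_cancel_left, add_sub_cancel_left, real_inner_smul_right,
    real_inner_self_eq_norm_sq] at h
  have h2 : ‖V x‖ ^ 2 ≤ 0 := nonpos_of_mul_nonpos_right h hε
  exact norm_eq_zero.1 (by nlinarith [norm_nonneg (V x)])

/-- Monotone sequences that are odd under index reversal and bounded by `B`. -/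
def oddMonotoneSeq (n : ℕ) (B : ℝ) : Set (Fin n → ℝ) :=
  {x | Monotone x ∧ (∀ j, x j.rev = -x j) ∧ ∀ j, x j ≤ B}

theorem neg_le_of_mem_oddMonotoneSeq {n : ℕ} {B : ℝ} {x : Fin n → ℝ}
    (hx : x ∈ oddMonotoneSeq n B) (j : Fin n) : -B ≤ x j := by
  have h1 := hx.2.1 j
  have h2 := hx.2.2 j.rev
  linarith

theorem isClosed_oddMonotoneSeq (n : ℕ) (B : ℝ) : IsClosed (oddMonotoneSeq n B) := by
  simp only [oddMonotoneSeq, Monotone, Set.ofPred_and, Set.ofPred_forall]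
  refine IsClosed.inter ?_ (IsClosed.inter ?_ ?_)
  · exact isClosed_iInter fun i => isClosed_iInter fun j => isClosed_iInter fun _ =>
      isClosed_le (continuous_apply i) (continuous_apply j)
  · exact isClosed_iInter fun i => isClosed_eq (continuous_apply _) (continuous_apply i).neg
  · exact isClosed_iInter fun i => isClosed_le (continuous_apply i) continuous_const

theorem convex_oddMonotoneSeq (n : ℕ) (B : ℝ) : Convex ℝ (oddMonotoneSeq n B) := by
  intro x hx y hy a b ha hb hab
  refine ⟨fun i j hij => ?_, fun j => ?_, fun j => ?_⟩ <;>
    simp only [Pi.add_apply, Pi.smul_apply, smul_eq_mul]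
  · exact add_le_add (mul_le_mul_of_nonneg_left (hx.1 hij) ha)
      (mul_le_mul_of_nonneg_left (hy.1 hij) hb)
  · rw [hx.2.1, hy.2.1]; ring
  · calc a * x j + b * y j ≤ a * B + b * B := add_le_add
          (mul_le_mul_of_nonneg_left (hx.2.2 j) ha) (mul_le_mul_of_nonneg_left (hy.2.2 j) hb)
      _ = B := by rw [← add_mul, hab, one_mul]

theorem eventually_add_mul_le_add_mul {a b c d : ℝ} (hab : a ≤ b) (h : a = b → c ≤ d) :
    ∀ᶠ ε : ℝ in nhdsWithin 0 (Set.Ioi 0), a + ε * c ≤ b + ε * d := by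
  rcases hab.eq_or_lt with hab | hab
  · filter_upwards [self_mem_nhdsWithin] with ε hε
    have := mul_le_mul_of_nonneg_left (h hab) (le_of_lt hε)
    linarith
  · refine Filter.Eventually.filter_mono nhdsWithin_le_nhds ?_
    have hc : Continuous fun ε : ℝ => a + ε * c := by fun_prop
    have hd : Continuous fun ε : ℝ => b + ε * d := by fun_prop
    have := (hc.tendsto 0).eventually_lt (hd.tendsto 0) (by simpa using hab)
    exact this.mono fun _ h => h.le

theorem eventually_add_smul_mem_oddMonotoneSeq {n : ℕ} {B : ℝ} {x v : Fin n → ℝ}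
    (hx : x ∈ oddMonotoneSeq n B) (hodd : ∀ j, v j.rev = -v j)
    (hmono : ∀ i j, i ≤ j → x i = x j → v i ≤ v j) (hB : ∀ j, x j = B → v j ≤ 0) :
    ∀ᶠ ε : ℝ in nhdsWithin 0 (Set.Ioi 0), x + ε • v ∈ oddMonotoneSeq n B := by
  have h1 : ∀ᶠ ε : ℝ in nhdsWithin 0 (Set.Ioi 0), ∀ i j, i ≤ j →
      x i + ε * v i ≤ x j + ε * v j := by
    refine Filter.eventually_all.2 fun i => Filter.eventually_all.2 fun j => ?_
    by_cases hij : i ≤ j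
    · exact (eventually_add_mul_le_add_mul (hx.1 hij) (hmono i j hij)).mono fun _ h _ => h
    · simp [hij]
  have h2 : ∀ᶠ ε : ℝ in nhdsWithin 0 (Set.Ioi 0), ∀ j, x j + ε * v j ≤ B + ε * 0 :=
    Filter.eventually_all.2 fun j => eventually_add_mul_le_add_mul (hx.2.2 j) (hB j)
  filter_upwards [h1, h2] with ε h1 h2
  refine ⟨fun i j hij => h1 i j hij, fun j => ?_, fun j => ?_⟩
  · simp only [Pi.add_apply, Pi.smul_apply, smul_eq_mul, hx.2.1, hodd]; ring
  · simpa using h2 j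

theorem theta_neg (U x : ℝ) : theta U (-x) = -theta U x := by
  rw [theta, theta, mul_neg, neg_div, Real.arctan_neg]; ring

theorem neg_pi_lt_theta (U x : ℝ) : -π < theta U x := by
  have := Real.arctan_lt_pi_div_two (2 * x / U)
  simp only [theta]
  linarith

theorem contDiff_theta (U : ℝ) : ContDiff ℝ 1 (theta U) := by
  have h : ContDiff ℝ 1 fun x : ℝ => 2 * x / U := by fun_prop
  exact contDiff_const.mul h.arctan

theorem tendsto_theta_atBot {U : ℝ} (hU : 0 < U) :
    Filter.Tendsto (theta U) Filter.atBot (nhds π) := by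
  have h1 : Filter.Tendsto (fun x : ℝ => 2 * x / U) Filter.atBot Filter.atBot :=
    (Filter.tendsto_id.const_mul_atBot two_pos).atBot_div_const hU
  have h2 := ((Real.tendsto_arctan_atBot.mono_right nhdsWithin_le_nhds).comp h1).const_mul (-2)
  have h3 : -2 * -(π / 2) = π := by ring
  rwa [h3] at h2

theorem sum_theta_rev {n : ℕ} (U a : ℝ) {y : Fin n → ℝ} (hy : ∀ j, y j.rev = -y j) :
    ∑ j, theta U (-a - y j) = -∑ j, theta U (a - y j) := by
  rw [← Equiv.sum_comp Fin.revPerm, ← Finset.sum_neg_distrib]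
  refine Finset.sum_congr rfl fun j _ => ?_
  rw [Fin.revPerm_apply, hy, ← theta_neg]
  congr 1
  ring

/-- The vector field whose zeros are the solutions of the Lieb–Wu equations, on the momenta. -/
noncomputable def momentumField (N M Na : ℕ) (U : ℝ) (k : Fin N → ℝ) (Λ : Fin M → ℝ)
    (j : Fin N) : ℝ :=
  2 * π * (((j : ℕ) : ℝ) + 1 - ((N : ℝ) + 1) / 2)
    + ∑ β : Fin M, theta U (2 * Real.sin (k j) - 2 * Λ β) - Na * k j

/-- The vector field whose zeros are the solutions of the Lieb–Wu equations, on the rapidities. -/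
noncomputable def rapidityField (N M : ℕ) (U : ℝ) (k : Fin N → ℝ) (Λ : Fin M → ℝ)
    (α : Fin M) : ℝ :=
  2 * π * (((α : ℕ) : ℝ) + 1 - ((M : ℝ) + 1) / 2) - ∑ β : Fin M, theta U (Λ α - Λ β)
    - ∑ j : Fin N, theta U (2 * Real.sin (k j) - 2 * Λ α)

theorem quantumNumber_rev {n : ℕ} (j : Fin n) :
    ((j.rev : ℕ) : ℝ) + 1 - ((n : ℝ) + 1) / 2 = -(((j : ℕ) : ℝ) + 1 - ((n : ℝ) + 1) / 2) := by
  rw [Fin.val_rev, Nat.cast_sub (by omega)]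
  push_cast
  ring

theorem momentumField_rev {N M Na : ℕ} {U : ℝ} {k : Fin N → ℝ} {Λ : Fin M → ℝ}
    (hk : ∀ j, k j.rev = -k j) (hΛ : ∀ α, Λ α.rev = -Λ α) (j : Fin N) :
    momentumField N M Na U k Λ j.rev = -momentumField N M Na U k Λ j := by
  have h := sum_theta_rev U (2 * Real.sin (k j)) (y := fun β => 2 * Λ β)
    (fun β => by rw [hΛ, mul_neg])
  simp only [momentumField, quantumNumber_rev, hk, Real.sin_neg, mul_neg, h]
  ring

theorem rapidityField_rev {N M : ℕ} {U : ℝ} {k : Fin N → ℝ} {Λ : Fin M → ℝ}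
    (hk : ∀ j, k j.rev = -k j) (hΛ : ∀ α, Λ α.rev = -Λ α) (α : Fin M) :
    rapidityField N M U k Λ α.rev = -rapidityField N M U k Λ α := by
  have h1 := sum_theta_rev U (Λ α) hΛ
  have h2 := sum_theta_rev U (2 * Λ α) (y := fun j => 2 * Real.sin (k j))
    (fun j => by rw [hk, Real.sin_neg, mul_neg])
  have h3 : ∀ a : ℝ, ∑ j, theta U (2 * Real.sin (k j) - a) =
      -∑ j, theta U (a - 2 * Real.sin (k j)) := fun a => by
    rw [← Finset.sum_neg_distrib]
    exact Finset.sum_congr rfl fun j _ => by rw [← theta_neg, neg_sub]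
  simp only [rapidityField, quantumNumber_rev, hΛ, mul_neg, h1, h3]
  rw [h2]
  ring

theorem momentumField_lt_of_eq {N M Na : ℕ} {U : ℝ} {k : Fin N → ℝ} {Λ : Fin M → ℝ} {i j : Fin N}
    (hij : i < j) (h : k i = k j) :
    momentumField N M Na U k Λ i < momentumField N M Na U k Λ j := by
  have h1 : ((i : ℕ) : ℝ) < (j : ℕ) := by exact_mod_cast hij
  simp only [momentumField, h]
  nlinarith [Real.pi_pos]

theorem rapidityField_lt_of_eq {N M : ℕ} {U : ℝ} {k : Fin N → ℝ} {Λ : Fin M → ℝ} {α β : Fin M}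
    (hαβ : α < β) (h : Λ α = Λ β) :
    rapidityField N M U k Λ α < rapidityField N M U k Λ β := by
  have h1 : ((α : ℕ) : ℝ) < (β : ℕ) := by exact_mod_cast hαβ
  simp only [rapidityField, h]
  nlinarith [Real.pi_pos]

theorem momentumField_nonpos_of_eq_pi {N M Na : ℕ} (hNa : N ≤ Na) {U : ℝ} {k : Fin N → ℝ}
    {Λ : Fin M → ℝ} (hΛ : ∀ α, Λ α.rev = -Λ α) {j : Fin N} (hj : k j = π) :
    momentumField N M Na U k Λ j ≤ 0 := by
  have h1 := sum_theta_rev U 0 (y := fun β => 2 * Λ β) (fun β => by rw [hΛ, mul_neg])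
  rw [neg_zero] at h1
  have h2 : ((j : ℕ) : ℝ) + 1 ≤ N := by exact_mod_cast j.2
  have h3 : (N : ℝ) ≤ Na := by exact_mod_cast hNa
  simp only [momentumField, hj, Real.sin_pi, mul_zero]
  nlinarith [Real.pi_pos]

theorem exists_rapidity_bound {N M : ℕ} (hM : 0 < M) (hMN : 2 * M ≤ N) {U : ℝ} (hU : 0 < U) :
    ∃ B : ℝ, 0 ≤ B ∧ ∀ (k : Fin N → ℝ) (Λ : Fin M → ℝ) (α : Fin M), Λ α = B →
      rapidityField N M U k Λ α ≤ 0 := by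
  have hN : (0 : ℝ) < N := by exact_mod_cast (by omega : 0 < N)
  have hπ : π * (N - 1) / N < π := by
    rw [div_lt_iff₀ hN]
    nlinarith [Real.pi_pos]
  obtain ⟨c, hc⟩ := Filter.eventually_atBot.1
    ((tendsto_theta_atBot hU).eventually (lt_mem_nhds hπ))
  refine ⟨max 0 ((2 - c) / 2), le_max_left _ _, fun k Λ α hα => ?_⟩
  have hB : (2 - c) / 2 ≤ Λ α := hα ▸ le_max_right _ _
  have h1 : π * (N - 1) ≤ ∑ j : Fin N, theta U (2 * Real.sin (k j) - 2 * Λ α) := by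
    have : ∀ j ∈ Finset.univ, π * (N - 1) / N ≤ theta U (2 * Real.sin (k j) - 2 * Λ α) :=
      fun j _ => (hc _ (by linarith [Real.sin_le_one (k j)])).le
    have h := Finset.card_nsmul_le_sum Finset.univ _ _ this
    rw [Finset.card_univ, Fintype.card_fin, nsmul_eq_mul, mul_div_cancel₀ _ hN.ne'] at h
    exact h
  have h2 : -π * (M - 1) ≤ ∑ β : Fin M, theta U (Λ α - Λ β) := by
    rw [← Finset.add_sum_erase _ _ (Finset.mem_univ α)]
    have h0 : theta U (Λ α - Λ α) = 0 := by simp [theta]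
    have h := Finset.card_nsmul_le_sum (Finset.univ.erase α) (fun β => theta U (Λ α - Λ β)) (-π)
      fun β _ => (neg_pi_lt_theta U _).le
    rw [Finset.card_erase_of_mem (Finset.mem_univ α), Finset.card_univ, Fintype.card_fin,
      nsmul_eq_mul, Nat.cast_sub hM, Nat.cast_one] at h
    linarith
  have h3 : ((α : ℕ) : ℝ) + 1 ≤ M := by exact_mod_cast α.2
  have h4 : 2 * (M : ℝ) ≤ N := by exact_mod_cast hMN
  simp only [rapidityField]
  nlinarith [Real.pi_pos]

/-- Pairs of sequences in `oddMonotoneSeq`, as a subset of a Euclidean space. -/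
def oddMonotonePair (N M : ℕ) (A B : ℝ) : Set (EuclideanSpace ℝ (Fin N ⊕ Fin M)) :=
  {z | (fun j => z (Sum.inl j)) ∈ oddMonotoneSeq N A ∧
    (fun α => z (Sum.inr α)) ∈ oddMonotoneSeq M B}

theorem isCompact_oddMonotonePair (N M : ℕ) (A B : ℝ) :
    IsCompact (oddMonotonePair N M A B) := by
  have h1 : IsCompact (Set.univ.pi fun i : Fin N ⊕ Fin M =>
      Sum.elim (fun _ => Set.Icc (-A) A) (fun _ => Set.Icc (-B) B) i) :=
    isCompact_univ_pi fun i => by cases i <;> exact isCompact_Icc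
  refine (h1.image (EuclideanSpace.equiv _ ℝ).symm.continuous).of_isClosed_subset ?_ ?_
  · refine IsClosed.inter ?_ ?_
    · exact (isClosed_oddMonotoneSeq N A).preimage (by fun_prop)
    · exact (isClosed_oddMonotoneSeq M B).preimage (by fun_prop)
  · intro z hz
    refine ⟨z, fun i _ => ?_, rfl⟩
    cases i with
    | inl j => exact ⟨neg_le_of_mem_oddMonotoneSeq hz.1 j, hz.1.2.2 j⟩
    | inr α => exact ⟨neg_le_of_mem_oddMonotoneSeq hz.2 α, hz.2.2.2 α⟩

theorem convex_oddMonotonePair (N M : ℕ) (A B : ℝ) : Convex ℝ (oddMonotonePair N M A B) :=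
  fun _ hx _ hy _ _ ha hb hab =>
    ⟨convex_oddMonotoneSeq N A hx.1 hy.1 ha hb hab, convex_oddMonotoneSeq M B hx.2 hy.2 ha hb hab⟩

/-- The momentum and rapidity fields together, on a Euclidean space. -/
noncomputable def liebWuField (N M Na : ℕ) (U : ℝ) (z : EuclideanSpace ℝ (Fin N ⊕ Fin M)) :
    EuclideanSpace ℝ (Fin N ⊕ Fin M) :=
  WithLp.toLp 2 (Sum.elim
    (momentumField N M Na U (fun j => z (Sum.inl j)) fun α => z (Sum.inr α))
    (rapidityField N M U (fun j => z (Sum.inl j)) fun α => z (Sum.inr α)))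

theorem contDiff_liebWuField (N M Na : ℕ) (U : ℝ) : ContDiff ℝ 1 (liebWuField N M Na U) := by
  have hθ := contDiff_theta U
  rw [contDiff_euclidean]
  rintro (j | α)
  · simp only [liebWuField, Sum.elim_inl, momentumField]
    fun_prop
  · simp only [liebWuField, Sum.elim_inr, rapidityField]
    fun_prop

/-- Existence of a real, ordered solution to the Lieb–Wu equations on a finite lattice:
`N` even, `M` odd, `2M ≤ N ≤ N_a`, `U > 0`.  Indices are zero-based, so the quantum
numbers are `I_j = (j+1) - (N+1)/2` and `J_α = (α+1) - (M+1)/2`. -/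
theorem liebWu_exists_ordered_solution
    (N M Na : ℕ) (hNpos : 0 < N) (hNeven : N % 2 = 0) (hModd : M % 2 = 1)
    (hMN : 2 * M ≤ N) (hNa : N ≤ Na) (U : ℝ) (hU : 0 < U) :
    ∃ (k : Fin N → ℝ) (Λ : Fin M → ℝ),
      StrictMono k ∧ StrictMono Λ ∧
      (∀ j : Fin N, k j ∈ Set.Icc (-π) π) ∧
      (∀ j : Fin N, (Na : ℝ) * k j =
          2 * π * (((j : ℕ) : ℝ) + 1 - ((N : ℝ) + 1) / 2)
            + ∑ β : Fin M, theta U (2 * Real.sin (k j) - 2 * Λ β)) ∧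
      (∀ α : Fin M, ∑ j : Fin N, theta U (2 * Real.sin (k j) - 2 * Λ α) =
          2 * π * (((α : ℕ) : ℝ) + 1 - ((M : ℝ) + 1) / 2)
            - ∑ β : Fin M, theta U (Λ α - Λ β)) := by
  obtain ⟨B, hB0, hB⟩ := exists_rapidity_bound (by omega) hMN hU
  have hne : (oddMonotonePair N M π B).Nonempty :=
    ⟨0, ⟨fun _ _ _ => le_rfl, fun _ => by simp, fun _ => Real.pi_pos.le⟩,
      ⟨fun _ _ _ => le_rfl, fun _ => by simp, fun _ => hB0⟩⟩
  have hcomp := isCompact_oddMonotonePair N M π B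
  have hconv := convex_oddMonotonePair N M π B
  obtain ⟨L, hL⟩ := (contDiff_liebWuField N M Na U).contDiffOn.exists_lipschitzOnWith
    one_ne_zero hconv hcomp
  obtain ⟨z, ⟨hk, hΛ⟩, hz⟩ := exists_zero_of_inward_lipschitz hne hcomp hconv hL (by
    rintro z ⟨hk, hΛ⟩
    have h1 := eventually_add_smul_mem_oddMonotoneSeq hk
      (momentumField_rev (Na := Na) (U := U) hk.2.1 hΛ.2.1)
      (fun i j hij h => hij.eq_or_lt.elim (fun h' => (congrArg _ h').le)
        fun h' => (momentumField_lt_of_eq (k := fun j => z (Sum.inl j)) h' h).le)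
      (fun j hj => momentumField_nonpos_of_eq_pi (k := fun j => z (Sum.inl j))
        (Λ := fun α => z (Sum.inr α)) hNa hΛ.2.1 hj)
    have h2 := eventually_add_smul_mem_oddMonotoneSeq hΛ
      (rapidityField_rev (U := U) (k := fun j => z (Sum.inl j))
        (Λ := fun α => z (Sum.inr α)) hk.2.1 hΛ.2.1)
      (fun i j hij h => hij.eq_or_lt.elim (fun h' => (congrArg _ h').le)
        fun h' => (rapidityField_lt_of_eq (Λ := fun α => z (Sum.inr α)) h' h).le)
      (fun α hα => hB _ _ α hα)
    obtain ⟨ε, ⟨h1, h2⟩, hε⟩ := ((h1.and h2).and self_mem_nhdsWithin).exists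
    exact ⟨ε, hε, h1, h2⟩)
  have hzk : ∀ j, momentumField N M Na U (fun j => z (Sum.inl j)) (fun α => z (Sum.inr α)) j = 0 :=
    fun j => congrArg (fun w : EuclideanSpace ℝ (Fin N ⊕ Fin M) => w (Sum.inl j)) hz
  have hzΛ : ∀ α, rapidityField N M U (fun j => z (Sum.inl j)) (fun α => z (Sum.inr α)) α = 0 :=
    fun α => congrArg (fun w : EuclideanSpace ℝ (Fin N ⊕ Fin M) => w (Sum.inr α)) hz
  refine ⟨fun j => z (Sum.inl j), fun α => z (Sum.inr α), fun i j hij => ?_, fun α β hαβ => ?_,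
    fun j => ⟨neg_le_of_mem_oddMonotoneSeq hk j, hk.2.2 j⟩, fun j => ?_, fun α => ?_⟩
  · refine lt_of_le_of_ne (hk.1 hij.le) fun h => ?_
    have := momentumField_lt_of_eq (Na := Na) (U := U) (k := fun j => z (Sum.inl j))
      (Λ := fun α => z (Sum.inr α)) hij h
    rw [hzk, hzk] at this
    exact lt_irrefl _ this
  · refine lt_of_le_of_ne (hΛ.1 hαβ.le) fun h => ?_
    have := rapidityField_lt_of_eq (U := U) (k := fun j => z (Sum.inl j))
      (Λ := fun α => z (Sum.inr α)) hαβ h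
    rw [hzΛ, hzΛ] at this
    exact lt_irrefl _ this
  · have := hzk j
    simp only [momentumField] at this
    linarith
  · have := hzΛ α
    simp only [rapidityField] at this
    linarith
end

section
/- With N even, M odd, 2M ≤ N ≤ N_a, M ≥ 1 and U > 0, the map φ is well defined on Ω (for each point of Ω and each α, the implicit equation defining Λ'_α has a unique real solution) and φ(Ω) ⊆ Ω. -/
open Real

/-- The constant `C_{N,U} = (U/4)·tan(π/2 - π/(2N)) + 1`. -/
noncomputable def CNU (N : ℕ) (U : ℝ) : ℝ :=
  U / 4 * Real.tan (Real.pi / 2 - Real.pi / (2 * N)) + 1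

/-- Membership in the domain `Ω`, stated for the full symmetric extensions
`k : Fin N → ℝ`, `Λ : Fin M → ℝ` (zero-based indices): `k j = -k j.rev`,
`Λ α = -Λ α.rev`, the upper half `k_{N/2+1} ≤ ⋯ ≤ k_N` (indices `N/2,…,N-1`)
lies in `[0, π]` and is monotone, and the upper half
`Λ_{(M+3)/2} ≤ ⋯ ≤ Λ_M` (indices `(M+1)/2,…,M-1`) lies in `[0, C_{N,U}]`
and is monotone. -/
def InOmega (N M : ℕ) (U : ℝ) (k : Fin N → ℝ) (Λ : Fin M → ℝ) : Prop :=
  (∀ j : Fin N, k j = - k j.rev) ∧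
  (∀ α : Fin M, Λ α = - Λ α.rev) ∧
  (∀ j : Fin N, N / 2 ≤ (j : ℕ) → 0 ≤ k j ∧ k j ≤ Real.pi) ∧
  (∀ j j' : Fin N, N / 2 ≤ (j : ℕ) → j ≤ j' → k j ≤ k j') ∧
  (∀ α : Fin M, (M + 1) / 2 ≤ (α : ℕ) → 0 ≤ Λ α ∧ Λ α ≤ CNU N U) ∧
  (∀ α α' : Fin M, (M + 1) / 2 ≤ (α : ℕ) → α ≤ α' → Λ α ≤ Λ α')

theorem theta_strictAnti {U : ℝ} (hU : 0 < U) : StrictAnti (theta U) := by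
  intro x y hxy
  have h : arctan (2 * x / U) < arctan (2 * y / U) :=
    arctan_strictMono (by gcongr)
  unfold theta
  linarith

theorem theta_zero (U : ℝ) : theta U 0 = 0 := by
  simp [theta]

theorem continuous_theta (U : ℝ) : Continuous (theta U) :=
  continuous_const.mul
    (continuous_arctan.comp ((continuous_const.mul continuous_id).div_const U))

/-- An odd function sums to zero over a family that is antisymmetric under reversal. -/
theorem sum_odd_eq_zero_of_rev {n : ℕ} {x : Fin n → ℝ} (hx : ∀ j, x j = -x j.rev)
    {f : ℝ → ℝ} (hf : ∀ t, f (-t) = -f t) : ∑ j, f (x j) = 0 := by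
  have h : ∑ j : Fin n, f (x j.rev) = ∑ j, f (x j) :=
    Equiv.sum_comp Fin.revPerm fun j => f (x j)
  have h' : ∑ j, f (x j) = -∑ j : Fin n, f (x j.rev) := by
    rw [← Finset.sum_neg_distrib]
    refine Finset.sum_congr rfl fun j _ => ?_
    rw [← hf, ← hx j]
  linarith

theorem one_le_CNU {N : ℕ} (hN : 0 < N) {U : ℝ} (hU : 0 < U) : 1 ≤ CNU N U := by
  have hN' : (1 : ℝ) ≤ N := by exact_mod_cast hN
  have h1 : π / (2 * N) ≤ π / 2 := by
    apply div_le_div_of_nonneg_left pi_pos.le <;> linarith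
  have h2 : 0 ≤ π / (2 * N) := by positivity
  have h3 : 0 ≤ tan (π / 2 - π / (2 * N)) :=
    tan_nonneg_of_nonneg_of_le_pi_div_two (by linarith) (by linarith)
  unfold CNU
  have := mul_nonneg (by positivity : 0 ≤ U / 4) h3
  linarith

theorem theta_two_sub_CNU {N : ℕ} (hN : 0 < N) {U : ℝ} (hU : 0 < U) :
    theta U (2 - 2 * CNU N U) = π - π / N := by
  have hN' : (1 : ℝ) ≤ N := by exact_mod_cast hN
  have h1 : π / (2 * N) ≤ π / 2 := by
    apply div_le_div_of_nonneg_left pi_pos.le <;> linarith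
  have h2 : 0 < π / (2 * N) := by positivity
  have h3 : 2 * (2 - 2 * CNU N U) / U = -tan (π / 2 - π / (2 * N)) := by
    unfold CNU
    field_simp
    ring
  rw [theta, h3, arctan_neg, arctan_tan (by linarith [pi_pos]) (by linarith)]
  field_simp

theorem strictMono_sum_theta {N : ℕ} (hN : 0 < N) {U : ℝ} (hU : 0 < U) (s : Fin N → ℝ) :
    StrictMono fun L : ℝ => ∑ j, theta U (s j - 2 * L) := by
  intro a b hab
  have : Nonempty (Fin N) := ⟨⟨0, hN⟩⟩
  refine Finset.sum_lt_sum_of_nonempty Finset.univ_nonempty fun j _ => ?_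
  exact theta_strictAnti hU (by linarith)

theorem sum_theta_CNU_ge {N : ℕ} (hN : 0 < N) {U : ℝ} (hU : 0 < U) (k : Fin N → ℝ) :
    N * π - π ≤ ∑ j, theta U (2 * sin (k j) - 2 * CNU N U) := by
  have h : ∑ _j : Fin N, (π - π / N) ≤ ∑ j, theta U (2 * sin (k j) - 2 * CNU N U) := by
    refine Finset.sum_le_sum fun j _ => ?_
    rw [← theta_two_sub_CNU hN hU]
    exact (theta_strictAnti hU).antitone (by linarith [sin_le_one (k j)])
  have hN' : (N : ℝ) ≠ 0 := by exact_mod_cast hN.ne'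
  rw [Finset.sum_const, Finset.card_univ, Fintype.card_fin, nsmul_eq_mul, mul_sub,
    mul_div_cancel₀ _ hN'] at h
  exact h

theorem sum_theta_sub_ge {M : ℕ} (U : ℝ) (Λ : Fin M → ℝ) (α : Fin M) :
    -((M - 1) * π) ≤ ∑ β, theta U (Λ α - Λ β) := by
  have hM : 1 ≤ M := by have := α.isLt; omega
  rw [← Finset.add_sum_erase _ _ (Finset.mem_univ α), sub_self, theta_zero, zero_add]
  have h : (Finset.univ.erase α).card • (-π) ≤
      ∑ β ∈ Finset.univ.erase α, theta U (Λ α - Λ β) :=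
    Finset.card_nsmul_le_sum _ _ _ fun β _ => (neg_pi_lt_theta U _).le
  rw [Finset.card_erase_of_mem (Finset.mem_univ α), Finset.card_univ, Fintype.card_fin,
    nsmul_eq_mul, Nat.cast_sub hM, Nat.cast_one] at h
  linarith

/-- The right-hand side of the equation for `Λ'` is monotone in `(α, Λ_α)`. -/
theorem spin_rhs_mono {M : ℕ} {U : ℝ} (hU : 0 < U) (Λ : Fin M → ℝ) {a b x y : ℝ}
    (hab : a ≤ b) (hxy : x ≤ y) :
    2 * π * a - ∑ β, theta U (x - Λ β) ≤ 2 * π * b - ∑ β, theta U (y - Λ β) := by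
  have h1 : ∑ β, theta U (y - Λ β) ≤ ∑ β, theta U (x - Λ β) :=
    Finset.sum_le_sum fun β _ => (theta_strictAnti hU).antitone (by linarith)
  have h2 : 2 * π * a ≤ 2 * π * b := by gcongr
  linarith

theorem sum_theta_nonpos {M : ℕ} {U : ℝ} (hU : 0 < U) {Λ : Fin M → ℝ}
    (hΛ : ∀ α, Λ α = -Λ α.rev) {s : ℝ} (hs : 0 ≤ s) :
    ∑ β, theta U (s - 2 * Λ β) ≤ 0 := by
  have h0 : ∑ β, theta U (2 * Λ β) = 0 :=
    sum_odd_eq_zero_of_rev (f := fun t => theta U (2 * t)) hΛ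
      fun t => by rw [mul_neg, theta_neg]
  have h : ∑ β, theta U (s - 2 * Λ β) ≤ ∑ β, -theta U (2 * Λ β) :=
    Finset.sum_le_sum fun β _ => by
      rw [← theta_neg]
      exact (theta_strictAnti hU).antitone (by linarith)
  rwa [Finset.sum_neg_distrib, h0, neg_zero] at h

theorem exists_spin_solution {N M : ℕ} (hN : 0 < N) (hMN : 2 * M ≤ N) {U : ℝ} (hU : 0 < U)
    {k : Fin N → ℝ} {Λ : Fin M → ℝ} (hk : ∀ j, k j = -k j.rev) (hΛ : ∀ α, Λ α = -Λ α.rev)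
    {α : Fin M} (hα : (M + 1) / 2 ≤ (α : ℕ)) (hΛα : 0 ≤ Λ α) :
    ∃ L ∈ Set.Icc 0 (CNU N U), ∑ j, theta U (2 * sin (k j) - 2 * L) =
      2 * π * (((α : ℕ) : ℝ) + 1 - ((M : ℝ) + 1) / 2) - ∑ β, theta U (Λ α - Λ β) := by
  have hcont : ContinuousOn (fun L : ℝ => ∑ j, theta U (2 * sin (k j) - 2 * L))
      (Set.Icc 0 (CNU N U)) := by
    refine (continuous_finsetSum _ fun j _ => ?_).continuousOn
    exact (continuous_theta U).comp (by fun_prop)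
  refine intermediate_value_Icc (by linarith [one_le_CNU hN hU]) hcont ⟨?_, ?_⟩
  · have h0 : ∑ j, theta U (2 * sin (k j)) = 0 :=
      sum_odd_eq_zero_of_rev (f := fun t => theta U (2 * sin t)) hk
        fun t => by rw [sin_neg, mul_neg, theta_neg]
    have h1 : ∑ β, theta U (0 - Λ β) = 0 :=
      sum_odd_eq_zero_of_rev (f := fun t => theta U (0 - t)) hΛ
        fun t => by rw [← theta_neg]; congr 1; ring
    have h2 : (M : ℝ) ≤ 2 * (α : ℕ) := by exact_mod_cast (by omega : M ≤ 2 * (α : ℕ))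
    have h3 := spin_rhs_mono hU Λ
      (by linarith : (0 : ℝ) ≤ ((α : ℕ) : ℝ) + 1 - ((M : ℝ) + 1) / 2) hΛα
    rw [h1] at h3
    simpa [h0] using h3
  · have h1 := sum_theta_CNU_ge hN hU k
    have h2 := sum_theta_sub_ge U Λ α
    have h3 : ((α : ℕ) : ℝ) + 1 ≤ M := by exact_mod_cast α.isLt
    have h4 : 2 * (M : ℝ) ≤ N := by exact_mod_cast hMN
    have h5 : 2 * π * (((α : ℕ) : ℝ) + 1 - ((M : ℝ) + 1) / 2) ≤ (M - 1) * π := by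
      nlinarith [pi_pos]
    have h6 : 2 * (M : ℝ) * π ≤ N * π := by gcongr
    show _ ≤ ∑ j, theta U (2 * sin (k j) - 2 * CNU N U)
    linarith [pi_pos]

theorem charge_update_le_pi {N M Na : ℕ} (hNa : N ≤ Na) {U : ℝ} (hU : 0 < U)
    {Λ : Fin M → ℝ} (hΛ : ∀ α, Λ α = -Λ α.rev) {x : ℝ} (hx0 : 0 ≤ x) (hxπ : x ≤ π)
    {i : ℕ} (hi : i < N) :
    (1 / (Na : ℝ)) * (2 * π * ((i : ℝ) + 1 - ((N : ℝ) + 1) / 2)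
      + ∑ β, theta U (2 * sin x - 2 * Λ β)) ≤ π := by
  have hs := sin_nonneg_of_nonneg_of_le_pi hx0 hxπ
  have h1 := sum_theta_nonpos hU hΛ (by positivity : 0 ≤ 2 * sin x)
  have h2 : (i : ℝ) + 1 ≤ N := by exact_mod_cast hi
  have h3 : (N : ℝ) ≤ Na := by exact_mod_cast hNa
  have h4 : (0 : ℝ) < Na := by exact_mod_cast (by omega : 0 < Na)
  rw [one_div, inv_mul_le_iff₀ h4]
  have h5 : 2 * π * ((i : ℝ) + 1 - ((N : ℝ) + 1) / 2) ≤ (N - 1) * π := by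
    nlinarith [pi_pos]
  have h6 : (N : ℝ) * π ≤ Na * π := by gcongr
  linarith [pi_pos]

/-- A monotone charge vector obtained from update values `g`: the recursion
`k'_i = max (k'_{i-1}) (g i)` started at `max 0 (g (N/2))`, extended antisymmetrically. -/
theorem exists_charge_vector {N : ℕ} (hN : 0 < N) (hNeven : N % 2 = 0) (g : Fin N → ℝ)
    (hg : ∀ i : Fin N, N / 2 ≤ (i : ℕ) → g i ≤ π) :
    ∃ k' : Fin N → ℝ, k' ⟨N / 2, by omega⟩ = max 0 (g ⟨N / 2, by omega⟩) ∧
      (∀ i : Fin N, N / 2 < (i : ℕ) →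
        k' i = max (k' ⟨(i : ℕ) - 1, lt_of_le_of_lt (Nat.sub_le _ _) i.isLt⟩) (g i)) ∧
      (∀ j, k' j = -k' j.rev) ∧
      (∀ j : Fin N, N / 2 ≤ (j : ℕ) → 0 ≤ k' j ∧ k' j ≤ π) ∧
      (∀ j j' : Fin N, N / 2 ≤ (j : ℕ) → j ≤ j' → k' j ≤ k' j') := by
  let G : ℕ → ℝ := fun n => if h : N / 2 + n < N then g ⟨N / 2 + n, h⟩ else 0
  let u : ℕ → ℝ := fun n => max 0 (partialSups G n)
  have hG : ∀ i : Fin N, N / 2 ≤ (i : ℕ) → G (i - N / 2) = g i := by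
    intro i hi
    have h : N / 2 + ((i : ℕ) - N / 2) = i := by omega
    simp [G, h]
  have hGπ : ∀ n, G n ≤ π := by
    intro n
    by_cases h : N / 2 + n < N
    · simpa [G, h] using hg ⟨N / 2 + n, h⟩ (by simp)
    · simpa [G, h] using pi_pos.le
  have hu : ∀ n, u (n + 1) = max (u n) (G (n + 1)) := by
    intro n
    simp only [u, partialSups_add_one, max_assoc]
  let k' : Fin N → ℝ := fun j =>
    if N / 2 ≤ (j : ℕ) then u (j - N / 2) else -u (j.rev - N / 2)
  have hk' : ∀ j : Fin N, N / 2 ≤ (j : ℕ) → k' j = u (j - N / 2) := fun j hj => if_pos hj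
  refine ⟨k', ?_, ?_, ?_, ?_, ?_⟩
  · rw [hk' _ le_rfl, ← hG _ le_rfl]
    simp [u]
  · intro i hi
    have h : (i : ℕ) - N / 2 = (i - 1 - N / 2) + 1 := by omega
    rw [hk' i hi.le, hk' _ (show N / 2 ≤ (i : ℕ) - 1 by omega), ← hG i hi.le, h, hu]
  · intro j
    have hj := j.isLt
    have hr : (j.rev : ℕ) = N - (j + 1) := Fin.val_rev j
    by_cases h : N / 2 ≤ (j : ℕ)
    · have h' : ¬ N / 2 ≤ (j.rev : ℕ) := by omega
      simp only [k', if_pos h, if_neg h', Fin.rev_rev, neg_neg]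
    · have h' : N / 2 ≤ (j.rev : ℕ) := by omega
      simp only [k', if_neg h, if_pos h']
  · intro j hj
    rw [hk' j hj]
    exact ⟨le_max_left _ _, max_le pi_pos.le (partialSups_le _ _ _ fun n _ => hGπ n)⟩
  · intro j j' hj hjj'
    have h : (j : ℕ) ≤ j' := hjj'
    rw [hk' j hj, hk' j' (hj.trans h)]
    exact max_le_max le_rfl ((partialSups G).monotone (by omega))

/-- The map `φ` is well defined on `Ω` (each `Λ'_α` is the unique solution of its
implicit equation) and maps `Ω` into `Ω`.  The image `(k', Λ')` is characterized by:
`k'_{N/2+1} = max{0, (1/N_a)(2π I_{N/2+1} + Σ_β θ_U(2 sin k_{N/2+1} - 2Λ_β))}`,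
`k'_i = max{k'_{i-1}, (1/N_a)(2π I_i + Σ_β θ_U(2 sin k_i - 2Λ_β))}` for `i > N/2+1`,
`Σ_j θ_U(2 sin k_j - 2Λ'_α) = 2π J_α - Σ_β θ_U(Λ_α - Λ_β)` on the upper half, and
the symmetric extension on the lower halves. -/
theorem phi_well_defined_and_maps_omega_into_omega
    (N M Na : ℕ) (hNpos : 0 < N) (hNeven : N % 2 = 0) (hModd : M % 2 = 1)
    (hMN : 2 * M ≤ N) (hNa : N ≤ Na) (U : ℝ) (hU : 0 < U)
    (k : Fin N → ℝ) (Λ : Fin M → ℝ) (hΩ : InOmega N M U k Λ) :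
    (∀ α : Fin M, (M + 1) / 2 ≤ (α : ℕ) →
      ∃! L : ℝ, ∑ j : Fin N, theta U (2 * Real.sin (k j) - 2 * L) =
        2 * π * (((α : ℕ) : ℝ) + 1 - ((M : ℝ) + 1) / 2)
          - ∑ β : Fin M, theta U (Λ α - Λ β)) ∧
    ∃ (k' : Fin N → ℝ) (Λ' : Fin M → ℝ),
      (k' ⟨N / 2, by omega⟩ = max 0 ((1 / (Na : ℝ)) *
          (2 * π * (((N / 2 : ℕ) : ℝ) + 1 - ((N : ℝ) + 1) / 2)
            + ∑ β : Fin M,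
                theta U (2 * Real.sin (k ⟨N / 2, by omega⟩) - 2 * Λ β)))) ∧
      (∀ i : Fin N, N / 2 < (i : ℕ) →
        k' i = max (k' ⟨(i : ℕ) - 1, lt_of_le_of_lt (Nat.sub_le _ _) i.isLt⟩)
          ((1 / (Na : ℝ)) *
            (2 * π * (((i : ℕ) : ℝ) + 1 - ((N : ℝ) + 1) / 2)
              + ∑ β : Fin M, theta U (2 * Real.sin (k i) - 2 * Λ β)))) ∧
      (∀ α : Fin M, (M + 1) / 2 ≤ (α : ℕ) →
        ∑ j : Fin N, theta U (2 * Real.sin (k j) - 2 * Λ' α) =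
          2 * π * (((α : ℕ) : ℝ) + 1 - ((M : ℝ) + 1) / 2)
            - ∑ β : Fin M, theta U (Λ α - Λ β)) ∧
      (∀ j : Fin N, k' j = - k' j.rev) ∧
      (∀ α : Fin M, Λ' α = - Λ' α.rev) ∧
      InOmega N M U k' Λ' := by
  obtain ⟨hk, hΛ, hkπ, -, hΛC, hΛmono⟩ := hΩ
  have hsol := fun (α : Fin M) (hα : (M + 1) / 2 ≤ (α : ℕ)) =>
    exists_spin_solution hNpos hMN hU hk hΛ hα (hΛC α hα).1
  have hmono := strictMono_sum_theta hNpos hU fun j => 2 * sin (k j)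
  refine ⟨fun α hα => ?_, ?_⟩
  · obtain ⟨L, -, hL⟩ := hsol α hα
    exact ⟨L, hL, fun L' hL' => hmono.injective (hL'.trans hL.symm)⟩
  obtain ⟨k', hk'0, hk'succ, hk'rev, hk'π, hk'mono⟩ := exists_charge_vector hNpos hNeven
    (fun i => (1 / (Na : ℝ)) * (2 * π * (((i : ℕ) : ℝ) + 1 - ((N : ℝ) + 1) / 2)
      + ∑ β : Fin M, theta U (2 * Real.sin (k i) - 2 * Λ β)))
    fun i hi => charge_update_le_pi hNa hU hΛ (hkπ i hi).1 (hkπ i hi).2 i.isLt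
  choose! S hSmem hSeq using hsol
  let Λ' : Fin M → ℝ := fun α =>
    if (M + 1) / 2 ≤ (α : ℕ) then S α
    else if (M + 1) / 2 ≤ (α.rev : ℕ) then -S α.rev else 0
  have hΛ' : ∀ α : Fin M, (M + 1) / 2 ≤ (α : ℕ) → Λ' α = S α := fun α hα => if_pos hα
  have hΛ'rev : ∀ α, Λ' α = -Λ' α.rev := by
    intro α
    have hα := α.isLt
    have hr : (α.rev : ℕ) = M - (α + 1) := Fin.val_rev α
    by_cases h : (M + 1) / 2 ≤ (α : ℕ)
    · have h' : ¬ (M + 1) / 2 ≤ (α.rev : ℕ) := by omega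
      simp only [Λ', Fin.rev_rev, if_pos h, if_neg h', neg_neg]
    · by_cases h' : (M + 1) / 2 ≤ (α.rev : ℕ)
      · simp only [Λ', if_neg h, if_pos h']
      · simp only [Λ', Fin.rev_rev, if_neg h, if_neg h', neg_zero]
  refine ⟨k', Λ', hk'0, hk'succ, fun α hα => ?_, hk'rev, hΛ'rev,
    hk'rev, hΛ'rev, hk'π, hk'mono, fun α hα => ?_, fun α α' hα hαα' => ?_⟩
  · rw [hΛ' α hα]
    exact hSeq α hα
  · rw [hΛ' α hα]
    exact hSmem α hα
  · have hle : (α : ℕ) ≤ α' := hαα'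
    have hα' : (M + 1) / 2 ≤ (α' : ℕ) := hα.trans hle
    rw [hΛ' α hα, hΛ' α' hα', ← hmono.le_iff_le]
    have hcast : ((α : ℕ) : ℝ) ≤ (α' : ℕ) := by exact_mod_cast hle
    refine (hSeq α hα).trans_le (le_trans ?_ (hSeq α' hα').ge)
    exact spin_rhs_mono hU Λ (by linarith) (hΛmono α α' hα hαα')
end

section
/- With N even, M odd, 2M ≤ N ≤ N_a, M ≥ 1 and U > 0, suppose (k, Λ) ∈ Ω is a fixed point of φ, i.e. φ(k, Λ) = (k, Λ). Then 0 < k_{N/2+1} < k_{N/2+2} < ⋯ < k_N < π and 0 < Λ_{(M+3)/2} < ⋯ < Λ_M, and the symmetric extensions (k_1,…,k_N, Λ_1,…,Λ_M) satisfy the Lieb–Wu equations: N_a·k_j = 2π·I_j + Σ_{β=1}^M θ_U(2·sin k_j − 2Λ_β) for all j = 1,…,N and Σ_{j=1}^N θ_U(2·sin k_j − 2Λ_α) = 2π·J_α − Σ_{β=1}^M θ_U(Λ_α − Λ_β) for all α = 1,…,M. -/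
open Real

theorem theta_antitone {U : ℝ} (hU : 0 < U) : Antitone (theta U) := by
  intro x y hxy
  have : Real.arctan (2 * x / U) ≤ Real.arctan (2 * y / U) :=
    Real.arctan_strictMono.monotone (by gcongr)
  unfold theta
  linarith

/-- Summing `θ_U (x - c·v_β)` over a reflection-antisymmetric family `v` gives an odd function
of `x`. -/
theorem sum_theta_neg_left (U c : ℝ) {m : ℕ} (v : Fin m → ℝ) (hv : ∀ β, v β = -v β.rev) (x : ℝ) :
    ∑ β, theta U (-x - c * v β) = -∑ β, theta U (x - c * v β) := by
  rw [← Equiv.sum_comp Fin.revPerm, ← Finset.sum_neg_distrib]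
  refine Finset.sum_congr rfl fun β _ => ?_
  rw [← theta_neg, Fin.revPerm_apply, hv β]
  congr 1
  ring

/-- Variant of `sum_theta_neg_left` with the roles of the two arguments exchanged. -/
theorem sum_theta_neg_right (U c : ℝ) {m : ℕ} (v : Fin m → ℝ) (hv : ∀ j, v j = -v j.rev) (x : ℝ) :
    ∑ j, theta U (c * v j - -x) = -∑ j, theta U (c * v j - x) := by
  rw [← Equiv.sum_comp Fin.revPerm, ← Finset.sum_neg_distrib]
  refine Finset.sum_congr rfl fun j _ => ?_
  rw [← theta_neg, Fin.revPerm_apply, hv j]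
  congr 1
  ring

/-- Over a reflection-antisymmetric family `v`, the sum of `θ_U (x - c·v_β)` is nonpositive for
`x ≥ 0`. -/
theorem sum_theta_nonpos_s6 {U : ℝ} (hU : 0 < U) (c : ℝ) {m : ℕ} (v : Fin m → ℝ)
    (hv : ∀ β, v β = -v β.rev) {x : ℝ} (hx : 0 ≤ x) :
    ∑ β, theta U (x - c * v β) ≤ 0 := by
  have h1 := sum_theta_neg_left U c v hv x
  have h2 : ∑ β, theta U (x - c * v β) ≤ ∑ β, theta U (-x - c * v β) :=
    Finset.sum_le_sum fun β _ => theta_antitone hU (by linarith)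
  linarith

/-- A fixed point of the map `φ` on `Ω` is strictly ordered (`0 < k_{N/2+1} < ⋯ < k_N < π`,
`0 < Λ_{(M+3)/2} < ⋯ < Λ_M`), and its symmetric extension solves the Lieb–Wu
equations. -/
theorem fixed_point_solves_liebWu
    (N M Na : ℕ) (hNpos : 0 < N) (hNeven : N % 2 = 0) (hModd : M % 2 = 1)
    (hMN : 2 * M ≤ N) (hNa : N ≤ Na) (U : ℝ) (hU : 0 < U)
    (k : Fin N → ℝ) (Λ : Fin M → ℝ) (hΩ : InOmega N M U k Λ)
    (hfix₁ : k ⟨N / 2, by omega⟩ = max 0 ((1 / (Na : ℝ)) *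
        (2 * π * (((N / 2 : ℕ) : ℝ) + 1 - ((N : ℝ) + 1) / 2)
          + ∑ β : Fin M, theta U (2 * Real.sin (k ⟨N / 2, by omega⟩) - 2 * Λ β))))
    (hfix₂ : ∀ i : Fin N, N / 2 < (i : ℕ) →
        k i = max (k ⟨(i : ℕ) - 1, lt_of_le_of_lt (Nat.sub_le _ _) i.isLt⟩)
          ((1 / (Na : ℝ)) *
            (2 * π * (((i : ℕ) : ℝ) + 1 - ((N : ℝ) + 1) / 2)
              + ∑ β : Fin M, theta U (2 * Real.sin (k i) - 2 * Λ β))))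
    (hfix₃ : ∀ α : Fin M, (M + 1) / 2 ≤ (α : ℕ) →
        ∑ j : Fin N, theta U (2 * Real.sin (k j) - 2 * Λ α) =
          2 * π * (((α : ℕ) : ℝ) + 1 - ((M : ℝ) + 1) / 2)
            - ∑ β : Fin M, theta U (Λ α - Λ β)) :
    (∀ j : Fin N, N / 2 ≤ (j : ℕ) → 0 < k j ∧ k j < π) ∧
    (∀ j j' : Fin N, N / 2 ≤ (j : ℕ) → j < j' → k j < k j') ∧
    (∀ α : Fin M, (M + 1) / 2 ≤ (α : ℕ) → 0 < Λ α) ∧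
    (∀ α α' : Fin M, (M + 1) / 2 ≤ (α : ℕ) → α < α' → Λ α < Λ α') ∧
    (∀ j : Fin N, (Na : ℝ) * k j =
        2 * π * (((j : ℕ) : ℝ) + 1 - ((N : ℝ) + 1) / 2)
          + ∑ β : Fin M, theta U (2 * Real.sin (k j) - 2 * Λ β)) ∧
    (∀ α : Fin M, ∑ j : Fin N, theta U (2 * Real.sin (k j) - 2 * Λ α) =
        2 * π * (((α : ℕ) : ℝ) + 1 - ((M : ℝ) + 1) / 2)
          - ∑ β : Fin M, theta U (Λ α - Λ β)) := by
  obtain ⟨hk, hΛ, hkpos, hkmono, hΛpos, hΛmono⟩ := hΩ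
  have hNaR : (0 : ℝ) < Na := by exact_mod_cast (by omega : 0 < Na)
  have hNaN : (N : ℝ) ≤ Na := by exact_mod_cast hNa
  have hN2 : ((N / 2 : ℕ) : ℝ) = (N : ℝ) / 2 := by
    have : 2 * (N / 2) = N := by omega
    have : (2 : ℝ) * ((N / 2 : ℕ) : ℝ) = N := by exact_mod_cast this
    linarith
  have hrevN : ∀ j : Fin N, ((j.rev : ℕ) : ℝ) = (N : ℝ) - 1 - (j : ℕ) := fun j => by
    have : (j.rev : ℕ) + 1 + (j : ℕ) = N := by rw [Fin.val_rev]; omega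
    have : ((j.rev : ℕ) : ℝ) + 1 + (j : ℕ) = N := by exact_mod_cast this
    linarith
  have hrevM : ∀ α : Fin M, ((α.rev : ℕ) : ℝ) = (M : ℝ) - 1 - (α : ℕ) := fun α => by
    have : (α.rev : ℕ) + 1 + (α : ℕ) = M := by rw [Fin.val_rev]; omega
    have : ((α.rev : ℕ) : ℝ) + 1 + (α : ℕ) = M := by exact_mod_cast this
    linarith
  have hodd : ∀ x : ℝ, ∑ β : Fin M, theta U (2 * Real.sin (-x) - 2 * Λ β) =
      -∑ β : Fin M, theta U (2 * Real.sin x - 2 * Λ β) := fun x => by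
    rw [Real.sin_neg, mul_neg]
    exact sum_theta_neg_left U 2 Λ hΛ _
  have hsin : ∀ j : Fin N, Real.sin (k j) = -Real.sin (k j.rev) := fun j => by
    rw [hk j, Real.sin_neg]
  have hoddK : ∀ x : ℝ, ∑ j : Fin N, theta U (2 * Real.sin (k j) - 2 * -x) =
      -∑ j : Fin N, theta U (2 * Real.sin (k j) - 2 * x) := fun x => by
    rw [mul_neg]
    exact sum_theta_neg_right U 2 (fun j => Real.sin (k j)) hsin _
  have hoddΛ : ∀ x : ℝ, ∑ β : Fin M, theta U (-x - Λ β) =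
      -∑ β : Fin M, theta U (x - Λ β) := fun x => by
    simpa using sum_theta_neg_left U 1 Λ hΛ x
  -- The charge equations in the upper half, together with positivity and one-step growth.
  have hbase : 0 < k ⟨N / 2, by omega⟩ ∧ (Na : ℝ) * k ⟨N / 2, by omega⟩ =
      2 * π * (((N / 2 : ℕ) : ℝ) + 1 - ((N : ℝ) + 1) / 2)
        + ∑ β : Fin M, theta U (2 * Real.sin (k ⟨N / 2, by omega⟩) - 2 * Λ β) := by
    have hpos : 0 < k ⟨N / 2, by omega⟩ := by
      refine lt_of_le_of_ne (hkpos _ le_rfl).1 fun h0 => ?_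
      have hz := hodd 0
      rw [← h0] at hfix₁
      have hle := hfix₁.symm ▸ le_max_right (0 : ℝ) _
      rw [neg_zero] at hz
      rw [show ∑ β : Fin M, theta U (2 * Real.sin 0 - 2 * Λ β) = 0 by linarith, hN2] at hle
      have : 0 < 1 / (Na : ℝ) * (2 * π * ((N : ℝ) / 2 + 1 - ((N : ℝ) + 1) / 2) + 0) := by
        rw [show 2 * π * ((N : ℝ) / 2 + 1 - ((N : ℝ) + 1) / 2) + 0 = π by ring]
        positivity
      linarith
    refine ⟨hpos, ?_⟩
    rcases max_choice (0 : ℝ) ((1 / (Na : ℝ)) *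
        (2 * π * (((N / 2 : ℕ) : ℝ) + 1 - ((N : ℝ) + 1) / 2)
          + ∑ β : Fin M, theta U (2 * Real.sin (k ⟨N / 2, by omega⟩) - 2 * Λ β))) with h | h
    · rw [h] at hfix₁
      exact absurd hfix₁ hpos.ne'
    · rw [h] at hfix₁
      rwa [one_div, eq_inv_mul_iff_mul_eq₀ hNaR.ne'] at hfix₁
  have hstep : ∀ i : ℕ, ∀ hi : i < N, N / 2 ≤ i → (Na : ℝ) * k ⟨i, hi⟩ =
        2 * π * ((i : ℝ) + 1 - ((N : ℝ) + 1) / 2)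
          + ∑ β : Fin M, theta U (2 * Real.sin (k ⟨i, hi⟩) - 2 * Λ β) →
      ∀ hi' : i + 1 < N, k ⟨i, hi⟩ < k ⟨i + 1, hi'⟩ ∧ (Na : ℝ) * k ⟨i + 1, hi'⟩ =
        2 * π * (((i + 1 : ℕ) : ℝ) + 1 - ((N : ℝ) + 1) / 2)
          + ∑ β : Fin M, theta U (2 * Real.sin (k ⟨i + 1, hi'⟩) - 2 * Λ β) := by
    intro i hi hiN heq hi'
    have hf := hfix₂ ⟨i + 1, hi'⟩ (by simp only; omega)
    simp only [Nat.add_sub_cancel] at hf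
    have hlt : k ⟨i, hi⟩ < k ⟨i + 1, hi'⟩ := by
      refine lt_of_le_of_ne (hf.symm ▸ le_max_left _ _) fun h0 => ?_
      have hle := hf.symm ▸ le_max_right (k ⟨i, hi⟩) _
      rw [← h0, one_div, inv_mul_le_iff₀ hNaR, heq] at hle
      push_cast at hle
      nlinarith [Real.pi_pos]
    refine ⟨hlt, ?_⟩
    rcases max_choice (k ⟨i, hi⟩) ((1 / (Na : ℝ)) *
        (2 * π * (((i + 1 : ℕ) : ℝ) + 1 - ((N : ℝ) + 1) / 2)
          + ∑ β : Fin M, theta U (2 * Real.sin (k ⟨i + 1, hi'⟩) - 2 * Λ β))) with h | h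
    · rw [h] at hf
      exact absurd hf hlt.ne'
    · rw [h] at hf
      rwa [one_div, eq_inv_mul_iff_mul_eq₀ hNaR.ne'] at hf
  have hcharge : ∀ i : ℕ, N / 2 ≤ i → ∀ hi : i < N, (Na : ℝ) * k ⟨i, hi⟩ =
        2 * π * ((i : ℝ) + 1 - ((N : ℝ) + 1) / 2)
          + ∑ β : Fin M, theta U (2 * Real.sin (k ⟨i, hi⟩) - 2 * Λ β) := by
    intro i hi
    induction i, hi using Nat.le_induction with
    | base => exact fun _ => hbase.2
    | succ i hi ih => exact fun hi' => (hstep i (by omega) hi (ih (by omega)) hi').2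
  refine ⟨fun j hj => ⟨?_, ?_⟩, fun j j' hj hjj' => ?_, fun α hα => ?_, fun α α' hα hαα' => ?_,
    fun j => ?_, fun α => ?_⟩
  · exact hbase.1.trans_le (hkmono _ j le_rfl hj)
  · have heq := hcharge j hj j.isLt
    have hs : ∑ β : Fin M, theta U (2 * Real.sin (k j) - 2 * Λ β) ≤ 0 :=
      sum_theta_nonpos_s6 hU 2 Λ hΛ
        (mul_nonneg two_pos.le (Real.sin_nonneg_of_nonneg_of_le_pi (hkpos j hj).1 (hkpos j hj).2))
    have hjN : ((j : ℕ) : ℝ) + 1 ≤ N := by exact_mod_cast j.isLt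
    by_contra! hge
    have : (Na : ℝ) * π ≤ Na * k j := by gcongr
    simp only [Fin.eta] at heq
    nlinarith [Real.pi_pos]
  · have hj1 : (j : ℕ) + 1 < N := by omega
    exact (hstep j j.isLt hj (hcharge j hj j.isLt) hj1).1.trans_le
      (hkmono _ j' (by simp only; omega) (by rw [Fin.le_def]; exact hjj'))
  · refine lt_of_le_of_ne (hΛpos α hα).1 fun h0 => ?_
    have hf := hfix₃ α hα
    rw [← h0] at hf
    have h1 := hoddK 0
    have h2 := hoddΛ 0
    rw [neg_zero] at h1 h2
    rw [self_eq_neg.1 h1, self_eq_neg.1 h2] at hf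
    have hM : (M : ℝ) + 1 ≤ 2 * (α : ℕ) := by exact_mod_cast (by omega : M + 1 ≤ 2 * (α : ℕ))
    nlinarith [Real.pi_pos]
  · refine lt_of_le_of_ne (hΛmono α α' hα hαα'.le) fun h0 => ?_
    have hf := hfix₃ α hα
    have hf' := hfix₃ α' (by omega)
    rw [← h0, hf] at hf'
    have : ((α : ℕ) : ℝ) + 1 ≤ (α' : ℕ) := by exact_mod_cast hαα'
    nlinarith [Real.pi_pos]
  · by_cases hj : N / 2 ≤ (j : ℕ)
    · exact hcharge j hj j.isLt
    · have h := hcharge j.rev (by rw [Fin.val_rev]; omega) j.rev.isLt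
      simp only [Fin.eta] at h
      rw [hrevN] at h
      rw [hk j, hodd, mul_neg, h]
      ring
  · by_cases hα : (M + 1) / 2 ≤ (α : ℕ)
    · exact hfix₃ α hα
    · by_cases hα' : (M + 1) / 2 ≤ (α.rev : ℕ)
      · have h := hfix₃ α.rev hα'
        rw [hrevM] at h
        rw [hΛ α, hoddK, hoddΛ, h]
        ring
      · rw [Fin.val_rev] at hα'
        have hmid : 2 * (α : ℕ) + 1 = M := by omega
        have hrev : α.rev = α := Fin.ext (by rw [Fin.val_rev]; omega)
        have h0 : Λ α = 0 := by
          have := hΛ α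
          rw [hrev] at this
          linarith
        have hM : 2 * ((α : ℕ) : ℝ) + 1 = M := by exact_mod_cast hmid
        have h1 := hoddK 0
        have h2 := hoddΛ 0
        rw [neg_zero] at h1 h2
        rw [h0, self_eq_neg.1 h1, self_eq_neg.1 h2, ← hM]
        ring
end

section
/- Let n ≥ 1, let S be any set of polynomials in ℂ[x_1,…,x_n], let V = {a ∈ ℂⁿ : f(a) = 0 for all f ∈ S} be its common zero set, and fix k ∈ {1,…,n}. Let π_k(V) = {a_k : a ∈ V} ⊆ ℂ be the projection of V onto the k-th coordinate. Then either π_k(V) is a finite set, or its complement ℂ ∖ π_k(V) is a finite set. -/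
/-- The point of the affine line `Spec K[X]` with coordinate `c`. -/
noncomputable def PrimeSpectrum.linePoint {K : Type*} [Field K] (c : K) : PrimeSpectrum (Polynomial K) :=
  PrimeSpectrum.comap (Polynomial.evalRingHom c) ⊥

theorem PrimeSpectrum.mem_linePoint {K : Type*} [Field K] {c : K} {f : Polynomial K} :
    f ∈ (linePoint c).asIdeal ↔ f.eval c = 0 := by
  simp [linePoint, PrimeSpectrum.asIdeal_bot]

/-- The `K`-points of a constructible subset of the affine line form a finite or cofinite set. -/
theorem PrimeSpectrum.finite_or_finite_compl_preimage_linePoint {K : Type*} [Field K]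
    {T : Set (PrimeSpectrum (Polynomial K))} (hT : Topology.IsConstructible T) :
    (linePoint ⁻¹' T).Finite ∨ (linePoint ⁻¹' T)ᶜ.Finite := by
  induction hT using Topology.IsConstructible.empty_union_induction with
  | open_retrocompact U hU _ =>
    obtain ⟨s, hs⟩ := (PrimeSpectrum.isOpen_iff U).mp hU
    rw [← Set.preimage_compl, hs]
    by_cases h : ∃ f ∈ s, f ≠ 0
    · obtain ⟨f, hf, hf0⟩ := h
      exact .inr <| (Polynomial.finite_setOfPred_isRoot hf0).subset fun c hc ↦
        mem_linePoint.mp (hc hf)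
    · push Not at h
      have : U = ∅ := by
        rw [← Set.compl_univ_iff, hs, Set.eq_univ_iff_forall]
        intro p f hf
        simp [h f hf]
      simp [this]
  | union s _ t _ hs ht =>
    rw [Set.preimage_union, Set.compl_union, Set.finite_union]
    rcases hs with hs | hs
    · exact ht.imp (fun ht ↦ ⟨hs, ht⟩) fun ht ↦ ht.inter_of_right _
    · exact .inr (hs.inter_of_left _)
  | compl s _ hs =>
    rw [Set.preimage_compl, compl_compl]
    exact hs.symm

/-- The coordinate function `X k` induces a finitely presented map from `K[X]`. -/
theorem MvPolynomial.finitePresentation_aeval_X {K σ : Type*} [Field K] [Finite σ] (k : σ) :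
    (Polynomial.aeval (R := K) (X k : MvPolynomial σ K)).toRingHom.FinitePresentation := by
  refine RingHom.FinitePresentation.of_finiteType.mp ?_
  refine RingHom.FiniteType.of_comp_finiteType (f := algebraMap K (Polynomial K)) ?_
  rw [AlgHom.toRingHom_eq_coe, AlgHom.comp_algebraMap, RingHom.finiteType_algebraMap]
  infer_instance

theorem MvPolynomial.comap_aeval_X_pointToPoint {K σ : Type*} [Field K] (k : σ) (a : σ → K) :
    PrimeSpectrum.comap (Polynomial.aeval (R := K) (X k : MvPolynomial σ K)).toRingHom
      (pointToPoint a) = PrimeSpectrum.linePoint (a k) := by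
  ext f
  rw [PrimeSpectrum.mem_linePoint]
  simp [pointToPoint, ← Polynomial.aeval_algHom_apply,
    Polynomial.coe_aeval_eq_eval]

/-- By the Nullstellensatz, a `K`-point of the line lies in the projection of the closed subscheme
cut out by `S` if and only if it lies in the projection of the `K`-points. -/
theorem MvPolynomial.preimage_linePoint_image_zeroLocus {K σ : Type*} [Field K] [IsAlgClosed K]
    [Finite σ] (S : Set (MvPolynomial σ K)) (k : σ) :
    PrimeSpectrum.linePoint ⁻¹'
      (PrimeSpectrum.comap (Polynomial.aeval (R := K) (X k : MvPolynomial σ K)).toRingHom ''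
        PrimeSpectrum.zeroLocus S) =
      (fun a : σ → K ↦ a k) '' {a | ∀ f ∈ S, eval a f = 0} := by
  ext c
  constructor
  · rintro ⟨p, hp, hpc⟩
    obtain ⟨m, hm, hpm⟩ := p.asIdeal.exists_le_maximal p.isPrime.ne_top
    obtain ⟨a, rfl⟩ := isMaximal_iff_eq_vanishingIdeal_singleton.mp hm
    have mem {f} (hf : f ∈ p.asIdeal) : eval a f = 0 := by
      simpa [mem_vanishingIdeal_singleton_iff, coe_aeval_eq_eval] using hpm hf
    refine ⟨a, fun f hf ↦ mem (hp hf), ?_⟩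
    have hc : Polynomial.X - Polynomial.C c ∈ (PrimeSpectrum.linePoint c).asIdeal := by
      simp [PrimeSpectrum.mem_linePoint]
    rw [← hpc] at hc
    simpa [sub_eq_zero, algebraMap_eq] using mem hc
  · rintro ⟨a, ha, rfl⟩
    refine ⟨pointToPoint a, fun f hf ↦ ?_, comap_aeval_X_pointToPoint k a⟩
    simpa [pointToPoint, mem_vanishingIdeal_singleton_iff, coe_aeval_eq_eval] using ha f hf


/-- The projection of an affine variety in `ℂⁿ` onto one coordinate is either finite
or cofinite in `ℂ`. -/
theorem variety_projection_finite_or_cofinite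
    (n : ℕ) (hn : 1 ≤ n) (S : Set (MvPolynomial (Fin n) ℂ)) (k : Fin n) :
    ((fun a : Fin n → ℂ => a k) ''
        {a : Fin n → ℂ | ∀ f ∈ S, MvPolynomial.eval a f = 0}).Finite ∨
    (((fun a : Fin n → ℂ => a k) ''
        {a : Fin n → ℂ | ∀ f ∈ S, MvPolynomial.eval a f = 0})ᶜ).Finite := by
  rw [← MvPolynomial.preimage_linePoint_image_zeroLocus S k]
  refine PrimeSpectrum.finite_or_finite_compl_preimage_linePoint
    (PrimeSpectrum.isConstructible_comap_image (MvPolynomial.finitePresentation_aeval_X k) ?_)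
  have hopen := (PrimeSpectrum.isClosed_zeroLocus S).isOpen_compl
  exact .of_compl <| (TopologicalSpace.NoetherianSpace.isCompact _).isConstructible hopen
end

section
/- Let n, m ≥ 1 and let p_1,…,p_m be polynomials in the n+1 complex variables (z_1,…,z_n,U). Suppose that for every real number u > 0 there exists z ∈ ℂⁿ with p_i(z, u) = 0 for all i = 1,…,m. Then the set of complex numbers u ∈ ℂ for which the system p_1(z,u) = ⋯ = p_m(z,u) = 0 has no solution z ∈ ℂⁿ is finite. -/
open PrimeSpectrum in
/-- A constructible subset of the affine line over a field which contains infinitely many rational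
points contains all but finitely many of them. -/
theorem IsConstructible.finite_setOf_comap_evalRingHom_notMem {K : Type*} [Field K]
    {s : Set (PrimeSpectrum (Polynomial K))} (hs : Topology.IsConstructible s)
    (hinf : {u : K | comap (Polynomial.evalRingHom u) ⊥ ∈ s}.Infinite) :
    {u : K | comap (Polynomial.evalRingHom u) ⊥ ∉ s}.Finite := by
  obtain ⟨D, rfl⟩ := exists_constructibleSetData_iff.mpr hs
  have mem_iff (C : BasicConstructibleSetData (Polynomial K)) (u : K) :
      comap (Polynomial.evalRingHom u) ⊥ ∈ C.toSet ↔
        (∀ i, (C.g i).eval u = 0) ∧ C.f.eval u ≠ 0 := by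
    simp [BasicConstructibleSetData.toSet, mem_zeroLocus, Set.range_subset_iff]
  obtain ⟨C, hCD, hC⟩ : ∃ C ∈ D,
      {u : K | comap (Polynomial.evalRingHom u) ⊥ ∈ C.toSet}.Infinite := by
    by_contra! hfin
    refine hinf ((D.finite_toSet.biUnion fun C hC => hfin C hC).subset ?_)
    intro u hu
    simpa [ConstructibleSetData.toSet] using hu
  have hg (i) : C.g i = 0 :=
    Polynomial.eq_zero_of_infinite_isRoot _ (hC.mono fun u hu => ((mem_iff C u).mp hu).1 i)
  obtain ⟨v, hv⟩ := hC.nonempty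
  have hf : C.f ≠ 0 := fun h0 => ((mem_iff C v).mp hv).2 (by simp [h0])
  refine (Polynomial.finite_setOfPred_isRoot hf).subset fun u hu => ?_
  by_contra hroot
  exact hu (Set.mem_biUnion hCD ((mem_iff C u).mpr ⟨fun i => by simp [hg i], hroot⟩))

/-- The values taken by a polynomial `t` on the zero locus of an ideal `I`, over an algebraically
closed field, are the rational points in the image of `Spec` of the coordinate ring under `t`. -/
theorem MvPolynomial.comap_evalRingHom_mem_range_comap_iff {K σ : Type*} [Field K] [IsAlgClosed K]
    [Finite σ] (I : Ideal (MvPolynomial σ K)) (t : MvPolynomial σ K) (u : K) :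
    PrimeSpectrum.comap (Polynomial.evalRingHom u) ⊥ ∈
        Set.range (PrimeSpectrum.comap ((Ideal.Quotient.mk I).comp
          (Polynomial.aeval t : Polynomial K →ₐ[K] MvPolynomial σ K).toRingHom)) ↔
      ∃ x ∈ zeroLocus K I, eval x t = u := by
  constructor
  · rintro ⟨Q, hQ⟩
    obtain ⟨M, hM, hQM⟩ := Q.asIdeal.exists_le_maximal Q.2.ne_top
    obtain ⟨x, hx⟩ := eq_vanishingIdeal_singleton_of_isMaximal K
      (Ideal.comap_isMaximal_of_surjective (Ideal.Quotient.mk I) Ideal.Quotient.mk_surjective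
        (K := M))
    have mem_iff (q : MvPolynomial σ K) : Ideal.Quotient.mk I q ∈ M ↔ eval x q = 0 := by
      rw [← Ideal.mem_comap, hx, mem_vanishingIdeal_singleton_iff, aeval_eq_eval]
    refine ⟨x, fun q hq => ?_, ?_⟩
    · have := (mem_iff q).mp (by simp [Ideal.Quotient.eq_zero_iff_mem.mpr hq])
      rwa [aeval_eq_eval]
    · have hX : (Polynomial.X - Polynomial.C u) ∈
          (PrimeSpectrum.comap (Polynomial.evalRingHom u) ⊥).asIdeal := by simp
      rw [← hQ] at hX
      have := (mem_iff (t - C u)).mp (hQM (by simpa [algebraMap_eq] using hX))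
      simpa [sub_eq_zero] using this
  · rintro ⟨x, hx, rfl⟩
    let ev : MvPolynomial σ K ⧸ I →+* K :=
      Ideal.Quotient.lift I (eval x) fun q hq => by simpa [aeval_eq_eval] using hx q hq
    refine ⟨PrimeSpectrum.comap ev ⊥, ?_⟩
    rw [← PrimeSpectrum.comap_comp_apply]
    congr 2
    have hev (q : MvPolynomial σ K) : ev (Ideal.Quotient.mk I q) = eval x q :=
      Ideal.Quotient.lift_mk _ _ _
    ext <;> simp [hev, algebraMap_eq]

/-- Over an algebraically closed field, a polynomial taking infinitely many values on an algebraic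
set omits only finitely many values on it. -/
theorem MvPolynomial.finite_compl_image_zeroLocus {K σ : Type*} [Field K] [IsAlgClosed K]
    [Finite σ] (I : Ideal (MvPolynomial σ K)) (t : MvPolynomial σ K)
    (hinf : ((fun x => eval x t) '' zeroLocus K I).Infinite) :
    ((fun x => eval x t) '' zeroLocus K I)ᶜ.Finite := by
  let φ : Polynomial K →+* MvPolynomial σ K ⧸ I := (Ideal.Quotient.mk I).comp
    (Polynomial.aeval t : Polynomial K →ₐ[K] MvPolynomial σ K).toRingHom
  have hft : φ.FiniteType := by
    refine RingHom.FiniteType.of_comp_finiteType (f := algebraMap K (Polynomial K)) ?_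
    have : φ.comp (algebraMap K (Polynomial K)) = algebraMap K (MvPolynomial σ K ⧸ I) := by
      ext a
      simp [φ]
      rfl
    rw [this, RingHom.finiteType_algebraMap]
    infer_instance
  have himage : (fun x => eval x t) '' zeroLocus K I =
      {u | PrimeSpectrum.comap (Polynomial.evalRingHom u) ⊥ ∈
        Set.range (PrimeSpectrum.comap φ)} := by
    ext u
    exact (comap_evalRingHom_mem_range_comap_iff I t u).symm
  rw [himage] at hinf ⊢
  exact IsConstructible.finite_setOf_comap_evalRingHom_notMem
    (PrimeSpectrum.isConstructible_range_comap
      (RingHom.FinitePresentation.of_finiteType.mp hft)) hinf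


/-- If a system of polynomial equations in `(z₁,…,zₙ,U)` is solvable in `z` for every
real `U > 0`, then it is solvable for all complex `U` outside a finite set.  The
variable `U` is the last coordinate, appended via `Fin.snoc`. -/
theorem solvable_outside_finite_set
    (n m : ℕ) (hn : 1 ≤ n) (hm : 1 ≤ m)
    (p : Fin m → MvPolynomial (Fin (n + 1)) ℂ)
    (h : ∀ u : ℝ, 0 < u → ∃ z : Fin n → ℂ,
      ∀ i : Fin m, MvPolynomial.eval (Fin.snoc z (u : ℂ)) (p i) = 0) :
    {u : ℂ | ¬ ∃ z : Fin n → ℂ,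
      ∀ i : Fin m, MvPolynomial.eval (Fin.snoc z u) (p i) = 0}.Finite := by
  have mem_image (u : ℂ) : u ∈ (fun x => MvPolynomial.eval x (MvPolynomial.X (Fin.last n))) ''
      MvPolynomial.zeroLocus ℂ (Ideal.span (Set.range p)) ↔
      ∃ z : Fin n → ℂ, ∀ i, MvPolynomial.eval (Fin.snoc z u) (p i) = 0 := by
    simp only [MvPolynomial.zeroLocus_span, Set.forall_mem_range, MvPolynomial.aeval_eq_eval,
      MvPolynomial.eval_X]
    constructor
    · rintro ⟨x, hx, rfl⟩
      refine ⟨Fin.init x, fun i => ?_⟩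
      rw [Fin.snoc_init_self]
      exact hx i
    · rintro ⟨z, hz⟩
      exact ⟨Fin.snoc z u, hz, Fin.snoc_last _ _⟩
  have hinf : ((fun x => MvPolynomial.eval x (MvPolynomial.X (Fin.last n))) ''
      MvPolynomial.zeroLocus ℂ (Ideal.span (Set.range p))).Infinite := by
    refine ((Set.Ioi_infinite (0 : ℝ)).image Complex.ofReal_injective.injOn).mono ?_
    rintro _ ⟨u, hu, rfl⟩
    exact (mem_image u).mpr (h u hu)
  refine (MvPolynomial.finite_compl_image_zeroLocus _ _ hinf).subset fun u hu => ?_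
  exact fun hmem => hu ((mem_image u).mp hmem)
end

section
/- Let n, m ≥ 1, let p_1,…,p_m be polynomials in the n+1 complex variables (z_1,…,z_n,U), and let V = {(z,u) ∈ ℂⁿ × ℂ : p_i(z,u) = 0 for all i}. Suppose that for every u ∈ ℂ the fiber {z ∈ ℂⁿ : (z,u) ∈ V} is finite. Then for each k ∈ {1,…,n} there exists a nonzero polynomial q in two complex variables such that q(z_k, u) = 0 for every (z, u) ∈ V. -/
/-- A dominant morphism of finite presentation over an integral base hits every point of some
nonempty basic open set. -/
theorem PrimeSpectrum.exists_basicOpen_subset_range_comap {R S : Type*} [CommRing R] [IsDomain R]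
    [CommRing S] {φ : R →+* S} (hφ : φ.FinitePresentation) (hinj : Function.Injective φ) :
    ∃ f : R, f ≠ 0 ∧ (PrimeSpectrum.basicOpen f : Set (PrimeSpectrum R)) ⊆
      Set.range (PrimeSpectrum.comap φ) := by
  obtain ⟨D, hD⟩ := PrimeSpectrum.exists_constructibleSetData_iff.mpr
    (PrimeSpectrum.isConstructible_range_comap hφ)
  obtain ⟨P, hP, hPbot⟩ := Ideal.exists_comap_eq_of_mem_minimalPrimes_of_injective hinj ⊥
    (by simp [IsDomain.minimalPrimes_eq_singleton_bot])
  have hbot : (⊥ : PrimeSpectrum R) ∈ D.toSet := by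
    rw [hD]
    exact ⟨⟨P, hP⟩, PrimeSpectrum.ext hPbot⟩
  simp only [PrimeSpectrum.ConstructibleSetData.toSet, Set.mem_iUnion] at hbot
  obtain ⟨C, hC, hg, hf⟩ := hbot
  have hf0 : C.f ≠ 0 := fun h ↦ hf (by simp [h])
  refine ⟨C.f, hf0, fun Q hQ ↦ ?_⟩
  rw [← hD]
  simp only [PrimeSpectrum.ConstructibleSetData.toSet, Set.mem_iUnion]
  refine ⟨C, hC, fun x hx ↦ ?_, fun h ↦ hQ (h rfl)⟩
  have : x = 0 := by simpa using hg hx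
  simp [this]

/-- The image of a dominant polynomial map from an affine algebraic set, the target being affine
space, contains the complement of a hypersurface. -/
theorem MvPolynomial.exists_forall_eval_ne_zero_exists_mem_zeroLocus {K σ τ : Type*} [Field K]
    [IsAlgClosed K] [Finite σ] [Finite τ] (I : Ideal (MvPolynomial σ K))
    (g : τ → MvPolynomial σ K) (hinj : ∀ q : MvPolynomial τ K, aeval g q ∈ I → q = 0) :
    ∃ f : MvPolynomial τ K, f ≠ 0 ∧ ∀ y : τ → K, eval y f ≠ 0 →
      ∃ x ∈ zeroLocus K I, ∀ t, eval x (g t) = y t := by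
  let φ : MvPolynomial τ K →ₐ[K] MvPolynomial σ K ⧸ I := (Ideal.Quotient.mkₐ K I).comp (aeval g)
  have hφinj : Function.Injective φ.toRingHom :=
    (injective_iff_map_eq_zero _).mpr fun q hq ↦ hinj q (Ideal.Quotient.eq_zero_iff_mem.mp hq)
  have hφ : φ.toRingHom.FinitePresentation := by
    refine RingHom.FinitePresentation.of_finiteType.mp ?_
    refine RingHom.FiniteType.of_comp_finiteType (f := algebraMap K (MvPolynomial τ K)) ?_
    rw [AlgHom.toRingHom_eq_coe, AlgHom.comp_algebraMap]
    exact RingHom.finiteType_algebraMap.mpr inferInstance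
  obtain ⟨f, hf0, hf⟩ := PrimeSpectrum.exists_basicOpen_subset_range_comap hφ hφinj
  refine ⟨f, hf0, fun y hy ↦ ?_⟩
  obtain ⟨Q, hQ⟩ := hf (show pointToPoint y ∈ PrimeSpectrum.basicOpen f by
    simpa [pointToPoint, PrimeSpectrum.mem_basicOpen] using hy)
  let P : Ideal (MvPolynomial σ K) := Q.asIdeal.comap (Ideal.Quotient.mk I)
  have hne : zeroLocus K P ≠ ∅ := fun h ↦ by
    have := IsPrime.vanishingIdeal_zeroLocus (K := K) P
    rw [h, vanishingIdeal_empty] at this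
    exact Ideal.IsPrime.ne_top' this.symm
  obtain ⟨x, hx⟩ := Set.nonempty_iff_ne_empty.mpr hne
  refine ⟨x, zeroLocus_anti_mono (fun a ha ↦ ?_) hx, fun t ↦ ?_⟩
  · simp [P, Ideal.mem_comap, Ideal.Quotient.eq_zero_iff_mem.mpr ha]
  · have hmem : (X t - C (y t) : MvPolynomial τ K) ∈ Q.asIdeal.comap φ.toRingHom := by
      rw [← PrimeSpectrum.comap_asIdeal, hQ]
      simp [pointToPoint]
    have hmem' : g t - C (y t) ∈ P := by
      simpa [φ, P, Ideal.mem_comap] using hmem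
    simpa [sub_eq_zero] using hx _ hmem'


/-- If every fiber (fixed `u`) of the solution variety of a polynomial system in
`(z₁,…,zₙ,U)` is finite, then each coordinate `z_k` of a solution satisfies a nonzero
polynomial relation `q(z_k, u) = 0`. -/
theorem algebraic_dependence_of_coordinates
    (n m : ℕ) (hn : 1 ≤ n) (hm : 1 ≤ m)
    (p : Fin m → MvPolynomial (Fin (n + 1)) ℂ)
    (hfin : ∀ u : ℂ, {z : Fin n → ℂ |
      ∀ i : Fin m, MvPolynomial.eval (Fin.snoc z u) (p i) = 0}.Finite)
    (k : Fin n) :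
    ∃ q : MvPolynomial (Fin 2) ℂ, q ≠ 0 ∧
      ∀ (z : Fin n → ℂ) (u : ℂ),
        (∀ i : Fin m, MvPolynomial.eval (Fin.snoc z u) (p i) = 0) →
        MvPolynomial.eval ![z k, u] q = 0 := by
  by_contra! hq
  let I : Ideal (MvPolynomial (Fin (n + 1)) ℂ) := Ideal.span (Set.range p)
  have hI (z : Fin n → ℂ) (u : ℂ) : (Fin.snoc z u : Fin (n + 1) → ℂ) ∈
      MvPolynomial.zeroLocus ℂ I ↔ ∀ i, MvPolynomial.eval (Fin.snoc z u) (p i) = 0 := by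
    simp [I, MvPolynomial.zeroLocus_span]
  obtain ⟨f, hf0, hf⟩ := MvPolynomial.exists_forall_eval_ne_zero_exists_mem_zeroLocus I
    ![MvPolynomial.X k.castSucc, MvPolynomial.X (Fin.last n)] fun q hqI ↦ by
      by_contra hq0
      obtain ⟨z, u, hzu, hne⟩ := hq q hq0
      refine hne ?_
      have h := (hI z u).mpr hzu _ hqI
      rw [← AlgHom.comp_apply, MvPolynomial.comp_aeval] at h
      convert h using 1
      rw [← MvPolynomial.coe_aeval_eq_eval]
      change MvPolynomial.aeval _ q = _
      congr 2
      ext i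
      fin_cases i <;> simp
  obtain ⟨y, hy⟩ : ∃ y, MvPolynomial.eval y f ≠ 0 := by
    by_contra! h
    exact hf0 (MvPolynomial.funext fun y ↦ by simp [h y])
  let g : Polynomial ℂ := MvPolynomial.aeval ![Polynomial.X, Polynomial.C (y 1)] f
  have hg (x : ℂ) : g.eval x = MvPolynomial.eval ![x, y 1] f := by
    rw [← Polynomial.coe_aeval_eq_eval, ← MvPolynomial.coe_aeval_eq_eval]
    change Polynomial.aeval x (MvPolynomial.aeval _ f) = MvPolynomial.aeval _ f
    rw [← AlgHom.comp_apply, MvPolynomial.comp_aeval]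
    congr 2
    ext i
    fin_cases i <;> simp
  have hg0 : g ≠ 0 := fun h ↦ hy <| by
    have hy' : ![y 0, y 1] = y := by ext i; fin_cases i <;> rfl
    simpa [h, hy'] using (hg (y 0)).symm
  have hroots : {x | g.eval x ≠ 0}.Infinite := by
    refine Set.Finite.infinite_compl (s := {x | g.eval x = 0}) ?_
    exact Polynomial.finite_setOfPred_isRoot hg0
  refine hroots (((hfin (y 1)).image fun z ↦ z k).subset fun x hx ↦ ?_)
  obtain ⟨w, hw, hwx⟩ := hf ![x, y 1] (by rwa [← hg])
  have hw0 : w k.castSucc = x := by simpa using hwx 0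
  have hw1 : w (Fin.last n) = y 1 := by simpa using hwx 1
  have hsnoc : (Fin.snoc (Fin.init w) (y 1) : Fin (n + 1) → ℂ) = w := by
    rw [← hw1, Fin.snoc_init_self]
  exact ⟨Fin.init w, (hI _ _).mp (by rwa [hsnoc]), hw0⟩
end

section
/- Let N be a positive integer, let 0 ≤ M ≤ N, and let k_1 < k_2 < ⋯ < k_N be real numbers with −π < k_1 and k_N < π. Let A be a complex-valued function on the symmetric group of permutations of {1,…,N}. Suppose that for every integer tuple (x_1,…,x_N) with x_j ∈ {1,…,N} for 1 ≤ j ≤ M and x_j ∈ {N+1,…,2N−M} for M < j ≤ N, one has Σ_P A(P)·exp(i·Σ_{j=1}^N k_{P(j)}·x_j) = 0, where the sum runs over all permutations P of {1,…,N}. Then A(P) = 0 for every permutation P. -/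
open Real

/-- A family of `n ≥ #S` consecutive powers separates the values of `v` on `S`: some linear
combination of them is the indicator of a given element of `S`. -/
theorem exists_sum_Ico_mul_pow_eq_ite {F ι : Type*} [Field F] [DecidableEq ι] {S : Finset ι}
    {v : ι → F} (hv : Set.InjOn v S) {b : ι} (hb : b ∈ S) (hvb : v b ≠ 0) {n : ℕ}
    (hn : S.card ≤ n) (c : ℕ) :
    ∃ w : ℕ → F, ∀ a ∈ S,
      ∑ x ∈ Finset.Ico c (c + n), w x * v a ^ x = if a = b then 1 else 0 := by
  refine ⟨fun x => (v b ^ c)⁻¹ * (Lagrange.basis S v b).coeff (x - c), fun a ha => ?_⟩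
  have hdeg : (Lagrange.basis S v b).natDegree < n := by
    have hpos : 0 < S.card := Finset.card_pos.mpr ⟨b, hb⟩
    have := Polynomial.natDegree_eq_of_degree_eq_some (Lagrange.degree_basis hv hb)
    omega
  calc ∑ x ∈ Finset.Ico c (c + n), (v b ^ c)⁻¹ * (Lagrange.basis S v b).coeff (x - c) * v a ^ x
      = (v b ^ c)⁻¹ * v a ^ c * (Lagrange.basis S v b).eval (v a) := by
        rw [Finset.sum_Ico_eq_sum_range, Polynomial.eval_eq_sum_range' hdeg, Finset.mul_sum]
        simp only [Nat.add_sub_cancel_left]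
        refine Finset.sum_congr rfl fun x _ => ?_
        ring
    _ = if a = b then 1 else 0 := by
        split_ifs with hab
        · subst hab
          rw [Lagrange.eval_basis_self hv hb, mul_one, inv_mul_cancel₀ (pow_ne_zero _ hvb)]
        · rw [Lagrange.eval_basis_of_ne (Ne.symm hab) ha, mul_zero]

/-- The map `x ↦ exp (i x)` is injective on `(-π, π]`. -/
theorem injOn_exp_I_mul_ofReal :
    Set.InjOn (fun x : ℝ => Complex.exp (Complex.I * x)) (Set.Ioc (-π) π) := by
  intro x hx y hy hxy
  have := Complex.exp_inj_of_neg_pi_lt_of_le_pi (x := Complex.I * x) (y := Complex.I * y)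
    (by simpa using hx.1) (by simpa using hx.2) (by simpa using hy.1) (by simpa using hy.2) hxy
  simpa using this

/-- Non-vanishing of the Bethe Ansatz wavefunction: if the plane-wave superposition
`Σ_P A(P) exp(i Σ_j k_{P(j)} x_j)` vanishes for all integer positions with
`x_j ∈ {1,…,N}` for the first `M` coordinates and `x_j ∈ {N+1,…,2N-M}` for the
remaining ones, where `-π < k_1 < ⋯ < k_N < π`, then all coefficients `A(P)` vanish. -/
theorem bethe_coefficients_vanish
    (N M : ℕ) (hN : 0 < N) (hMN : M ≤ N)
    (k : Fin N → ℝ) (hk : StrictMono k)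
    (hk₁ : -π < k ⟨0, hN⟩) (hkN : k ⟨N - 1, by omega⟩ < π)
    (A : Equiv.Perm (Fin N) → ℂ)
    (h : ∀ x : Fin N → ℕ,
      (∀ j : Fin N, (j : ℕ) < M → x j ∈ Finset.Icc 1 N) →
      (∀ j : Fin N, M ≤ (j : ℕ) → x j ∈ Finset.Icc (N + 1) (2 * N - M)) →
      ∑ P : Equiv.Perm (Fin N), A P *
        Complex.exp (Complex.I * ∑ j : Fin N, (k (P j) : ℂ) * (x j : ℂ)) = 0) :
    ∀ P : Equiv.Perm (Fin N), A P = 0 := by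
  classical
  set z : Fin N → ℂ := fun a => Complex.exp (Complex.I * k a) with hz
  have hz_inj : Function.Injective z := by
    have hmem (a : Fin N) : k a ∈ Set.Ioc (-π) π :=
      ⟨hk₁.trans_le (hk.monotone (Fin.mk_le_of_le_val (Nat.zero_le _))),
        (hk.monotone (Fin.le_def.mpr (by have := a.isLt; simp; omega))).trans hkN.le⟩
    exact fun a b hab => hk.injective (injOn_exp_I_mul_ofReal (hmem a) (hmem b) hab)
  have hexp (P : Equiv.Perm (Fin N)) (x : Fin N → ℕ) :
      Complex.exp (Complex.I * ∑ j, (k (P j) : ℂ) * (x j : ℂ)) = ∏ j, z (P j) ^ x j := by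
    rw [Finset.mul_sum, Complex.exp_sum]
    refine Finset.prod_congr rfl fun j _ => ?_
    rw [hz, ← Complex.exp_nat_mul]
    congr 1
    ring
  intro Q
  set low : Finset (Fin N) := Finset.univ.filter fun j => (j : ℕ) < M with hlow
  have hlow_card : low.card = M := by
    rw [hlow, Fin.card_filter_val_lt, min_eq_right hMN]
  set S : Fin N → Finset (Fin N) := fun j =>
    if (j : ℕ) < M then Finset.univ else (low.map Q.toEmbedding)ᶜ with hS
  set R : Fin N → Finset ℕ := fun j =>
    if (j : ℕ) < M then Finset.Ico 1 (1 + N) else Finset.Ico (N + 1) (N + 1 + (N - M)) with hR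
  have hmem_S {P : Equiv.Perm (Fin N)} (hP : ∀ j : Fin N, (j : ℕ) < M → P j = Q j) (j : Fin N) :
      P j ∈ S j := by
    by_cases hj : (j : ℕ) < M
    · simp [hS, hj]
    · simp only [hS, hj, if_false, Finset.mem_compl, Finset.mem_map, not_exists, not_and]
      intro i hi hij
      have hiM : (i : ℕ) < M := by simpa [hlow] using hi
      have : i = j := P.injective ((hP i hiM).trans hij)
      exact hj (this ▸ hiM)
  have hw (j : Fin N) : ∃ w : ℕ → ℂ, ∀ a ∈ S j,
      ∑ x ∈ R j, w x * z a ^ x = if a = Q j then 1 else 0 := by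
    have hQ : Q j ∈ S j := hmem_S (fun _ _ => rfl) j
    by_cases hj : (j : ℕ) < M
    · simp only [hR, hj, if_true]
      exact exists_sum_Ico_mul_pow_eq_ite hz_inj.injOn hQ (Complex.exp_ne_zero _)
        (by simp [hS, hj]) 1
    · simp only [hR, hj, if_false]
      exact exists_sum_Ico_mul_pow_eq_ite hz_inj.injOn hQ (Complex.exp_ne_zero _)
        (by simp [hS, hj, Finset.card_compl, hlow_card]) (N + 1)
  choose w hw using hw
  have hprod (P : Equiv.Perm (Fin N)) :
      ∏ j, ∑ x ∈ R j, w j x * z (P j) ^ x = if P = Q then 1 else 0 := by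
    split_ifs with hPQ
    · subst hPQ
      exact Finset.prod_eq_one fun j _ => by rw [hw j _ (hmem_S (fun _ _ => rfl) j), if_pos rfl]
    · suffices ∃ j, P j ∈ S j ∧ P j ≠ Q j by
        obtain ⟨j, hj, hne⟩ := this
        exact Finset.prod_eq_zero (Finset.mem_univ j) (by rw [hw j _ hj, if_neg hne])
      by_cases hP : ∀ j : Fin N, (j : ℕ) < M → P j = Q j
      · obtain ⟨j, hj⟩ : ∃ j, P j ≠ Q j := by
          by_contra! hall
          exact hPQ (Equiv.ext hall)
        exact ⟨j, hmem_S hP j, hj⟩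
      · push Not at hP
        obtain ⟨j, hj, hne⟩ := hP
        exact ⟨j, by simp [hS, hj], hne⟩
  calc A Q = ∑ P, A P * ∏ j, ∑ x ∈ R j, w j x * z (P j) ^ x := by
        simp [hprod]
    _ = ∑ x ∈ Fintype.piFinset R, (∏ j, w j (x j)) * ∑ P, A P * ∏ j, z (P j) ^ x j := by
        simp only [Finset.prod_univ_sum, Finset.mul_sum]
        rw [Finset.sum_comm]
        refine Finset.sum_congr rfl fun x _ => Finset.sum_congr rfl fun P _ => ?_
        rw [Finset.prod_mul_distrib]
        ring
    _ = 0 := by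
        refine Finset.sum_eq_zero fun x hx => ?_
        rw [Fintype.mem_piFinset] at hx
        have hsum := h x
          (fun j hj => by
            have := hx j
            simp only [hR, hj, if_true, Finset.mem_Ico] at this
            rw [Finset.mem_Icc]
            omega)
          (fun j hj => by
            have := hx j
            simp only [hR, not_lt.mpr hj, if_false, Finset.mem_Ico] at this
            rw [Finset.mem_Icc]
            omega)
        simp only [hexp] at hsum
        rw [hsum, mul_zero]
end

section
/- Let U > 0, let N_a and M be positive integers, let Λ_1,…,Λ_M ∈ ℝ, let I be an integer (or half-integer, i.e. 2I ∈ ℤ), and suppose k, k' ∈ ℝ satisfy N_a·k = 2π·I + Σ_{β=1}^M θ_U(2·sin k − 2Λ_β) and N_a·k' = 2π·(I+1) + Σ_{β=1}^M θ_U(2·sin k' − 2Λ_β). Then |k' − k| ≥ 2π·U/(N_a·U + 8M). -/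
open Real

/-- The arctangent is nonexpansive. -/
theorem lipschitzWith_arctan : LipschitzWith 1 Real.arctan := by
  refine lipschitzWith_of_nnnorm_deriv_le Real.differentiable_arctan fun x => ?_
  rw [← NNReal.coe_le_coe, coe_nnnorm, Real.deriv_arctan, Real.norm_of_nonneg (by positivity),
    NNReal.coe_one]
  exact div_le_one_of_le₀ (by nlinarith [sq_nonneg x]) (by positivity)

theorem abs_arctan_sub_arctan_le (x y : ℝ) :
    |Real.arctan x - Real.arctan y| ≤ |x - y| := by
  simpa [Real.dist_eq] using lipschitzWith_arctan.dist_le_mul x y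

theorem abs_theta_sub_theta_le {U : ℝ} (hU : 0 < U) (x y : ℝ) :
    |theta U x - theta U y| ≤ 4 / U * |x - y| := by
  calc |theta U x - theta U y|
      = 2 * |Real.arctan (2 * x / U) - Real.arctan (2 * y / U)| := by
        rw [theta, theta, ← mul_sub, abs_mul]; norm_num
    _ ≤ 2 * |2 * x / U - 2 * y / U| := 
        mul_le_mul_of_nonneg_left (abs_arctan_sub_arctan_le _ _) zero_le_two
    _ = 4 / U * |x - y| := by
        rw [show 2 * x / U - 2 * y / U = 2 / U * (x - y) by ring, abs_mul,
          abs_of_pos (div_pos two_pos hU)]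
        ring

theorem abs_theta_sin_sub_le {U : ℝ} (hU : 0 < U) (k k' c : ℝ) :
    |theta U (2 * Real.sin k' - c) - theta U (2 * Real.sin k - c)| ≤ 8 / U * |k' - k| := by
  calc |theta U (2 * Real.sin k' - c) - theta U (2 * Real.sin k - c)|
      ≤ 4 / U * |2 * Real.sin k' - c - (2 * Real.sin k - c)| := abs_theta_sub_theta_le hU _ _
    _ = 8 / U * |Real.sin k' - Real.sin k| := by
        rw [sub_sub_sub_cancel_right, ← mul_sub, abs_mul, abs_two]
        ring
    _ ≤ 8 / U * |k' - k| := 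
        mul_le_mul_of_nonneg_left (Real.abs_sin_sub_sin_le _ _) (by positivity)

/-- Two consecutive charge momenta (with quantum numbers `I` and `I+1`, `2I ∈ ℤ`)
are separated by at least `2πU/(N_a U + 8M)`. -/
theorem consecutive_k_separation
    (U : ℝ) (hU : 0 < U) (Na M : ℕ) (hNa : 0 < Na) (hM : 0 < M)
    (Λ : Fin M → ℝ) (I : ℝ) (hI : ∃ z : ℤ, (z : ℝ) = 2 * I) (k k' : ℝ)
    (h₁ : (Na : ℝ) * k = 2 * π * I
        + ∑ β : Fin M, theta U (2 * Real.sin k - 2 * Λ β))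
    (h₂ : (Na : ℝ) * k' = 2 * π * (I + 1)
        + ∑ β : Fin M, theta U (2 * Real.sin k' - 2 * Λ β)) :
    2 * π * U / ((Na : ℝ) * U + 8 * (M : ℝ)) ≤ |k' - k| := by
  have hsum : |∑ β : Fin M, (theta U (2 * Real.sin k' - 2 * Λ β)
      - theta U (2 * Real.sin k - 2 * Λ β))| ≤ M * (8 / U * |k' - k|) := by
    refine (Finset.abs_sum_le_sum_abs _ _).trans ?_
    refine (Finset.sum_le_card_nsmul _ _ _ fun β _ => abs_theta_sin_sub_le hU k k' _).trans ?_
    simp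
  rw [Finset.sum_sub_distrib] at hsum
  have hle : 2 * π ≤ Na * |k' - k| + M * (8 / U * |k' - k|) := by
    have hlin : (Na : ℝ) * (k' - k) ≤ Na * |k' - k| := by gcongr; exact le_abs_self _
    linarith [(abs_le.mp hsum).1]
  have hNa' : (0 : ℝ) < Na := by exact_mod_cast hNa
  rw [div_le_iff₀ (by positivity)]
  calc 2 * π * U ≤ (Na * |k' - k| + M * (8 / U * |k' - k|)) * U := by gcongr
    _ = |k' - k| * (Na * U + 8 * M) := by field_simp
end
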